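/- arXiv:2604.27634 — 6 statements merged into one kernel-verified Lean document; each statement's English description precedes it below -/
import Mathlib

section
/- Let X be a topological space and X = X_1 ⊔ … ⊔ X_n a locally closed decomposition of X. The given order X_1, …, X_n filters X if and only if for all indices i, j, whenever X_i ∩ closure(X_j) ≠ ∅ we have i ≤ j. (This is Proposition 'filter_cond' of the paper; its proof is purely topological, so it is stated for topological spaces.) -/
/-- **Proposition (filter_cond).**
Let `X` be a topological space and `X = X 1 ⊔ … ⊔ X n` a locally closed decomposition of `X`
(a partition into pairwise disjoint locally closed subsets).  The given order filters `X`
(each partial union `X 1 ∪ … ∪ X j` is closed) if and only if for all indices `i, j`,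
whenever `X i ∩ closure (X j) ≠ ∅` we have `i ≤ j`. -/
theorem filter_cond {α : Type*} [TopologicalSpace α] {n : ℕ} (X : Fin n → Set α)
    (hdisj : Pairwise (Function.onFun Disjoint X))
    (hlc : ∀ i, IsLocallyClosed (X i))
    (hcover : ⋃ i, X i = Set.univ) :
    (∀ j : Fin n, IsClosed (⋃ i ≤ j, X i)) ↔
      ∀ i j : Fin n, (X i ∩ closure (X j)).Nonempty → i ≤ j := by
  constructor
  · rintro h i j ⟨x, hxi, hxj⟩
    have hsub : closure (X j) ⊆ ⋃ i ≤ j, X i :=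
      closure_minimal (Set.subset_biUnion_of_mem (u := X) (le_refl j)) (h j)
    obtain ⟨k, hkj, hxk⟩ := Set.mem_iUnion₂.mp (hsub hxj)
    by_contra hij
    have hik : i ≠ k := fun e => hij (e ▸ hkj)
    exact Set.disjoint_left.mp (hdisj hik) hxi hxk
  · intro h j
    have hunion : ⋃ i ≤ j, X i = ⋃ i ∈ Set.Iic j, closure (X i) := by
      apply Set.Subset.antisymm
      · exact Set.iUnion₂_mono fun i _ => subset_closure
      · intro x hx
        obtain ⟨i, hij, hxi⟩ := Set.mem_iUnion₂.mp hx
        obtain ⟨k, hxk⟩ := Set.iUnion_eq_univ_iff.mp hcover x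
        exact Set.mem_iUnion₂.mpr ⟨k, (h k i ⟨x, hxk, hxi⟩).trans hij, hxk⟩
    rw [hunion]
    exact (Set.toFinite _).isClosed_biUnion fun i _ => isClosed_closure
end

section
/- Let X be a topological space and X = X_1 ⊔ … ⊔ X_n a locally closed decomposition of X. Define a relation R on the index set {1, …, n} by: R i j holds if and only if i ≠ j and X_i ∩ closure(X_j) ≠ ∅. Then the decomposition is filterable (i.e., there exists a permutation σ of {1, …, n} such that the ordering X_{σ(1)}, …, X_{σ(n)} filters X) if and only if R has no directed cycles, i.e., the transitive closure of R is irreflexive. (This equivalence is the purely topological part of the proof of the paper's Theorem that filterability of the Białynicki-Birula decomposition is equivalent to acyclicity of the orbit graph.) -/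
/-- A relation without directed cycles on a finite type admits a topological sort. -/
theorem exists_equiv_fin_lt_of_transGen_irrefl {ι : Type*} [Fintype ι] {n : ℕ}
    (hn : Fintype.card ι = n) {r : ι → ι → Prop} (hr : ∀ i, ¬ Relation.TransGen r i i) :
    ∃ σ : Fin n ≃ ι, ∀ i j, r i j → σ.symm i < σ.symm j := by
  classical
  let P : PartialOrder ι :=
    { le := Relation.ReflTransGen r
      le_refl := fun _ => .refl
      le_trans := fun _ _ _ => .trans
      le_antisymm := fun a b hab hba => by
        rcases Relation.reflTransGen_iff_eq_or_transGen.1 hab with h | h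
        · exact h.symm
        · exact (hr a (h.trans_left hba)).elim }
  let : Fintype (LinearExtension ι) := ‹Fintype ι›
  let e := monoEquivOfFin (LinearExtension ι) hn
  refine ⟨e.toEquiv, fun i j hij => ?_⟩
  have hle : (toLinearExtension i : LinearExtension ι) ≤ toLinearExtension j :=
    toLinearExtension.monotone (Relation.ReflTransGen.single hij : P.le i j)
  have hne : i ≠ j := fun h => hr i (.single (h ▸ hij))
  exact lt_of_le_of_ne (e.symm.monotone hle) fun h => hne (e.symm.injective h)

/-- **Theorem (filterability ↔ acyclicity, topological part).**
Let `X = X 1 ⊔ … ⊔ X n` be a locally closed decomposition of a topological space.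
Define `R i j ↔ i ≠ j ∧ X i ∩ closure (X j) ≠ ∅`.  The decomposition is filterable
(some reordering of the pieces filters `X`) if and only if `R` has no directed cycles,
i.e. the transitive closure of `R` is irreflexive. -/
theorem filterable_iff_acyclic {α : Type*} [TopologicalSpace α] {n : ℕ} (X : Fin n → Set α)
    (hdisj : Pairwise (Function.onFun Disjoint X))
    (hlc : ∀ i, IsLocallyClosed (X i))
    (hcover : ⋃ i, X i = Set.univ) :
    (∃ σ : Equiv.Perm (Fin n), ∀ j : Fin n, IsClosed (⋃ m ≤ j, X (σ m))) ↔
      ∀ i : Fin n,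
        ¬ Relation.TransGen (fun i j => i ≠ j ∧ (X i ∩ closure (X j)).Nonempty) i i := by
  constructor
  · rintro ⟨σ, hσ⟩ i hi
    have hlt : ∀ i j, i ≠ j ∧ (X i ∩ closure (X j)).Nonempty → σ.symm i < σ.symm j := by
      rintro i j ⟨hij, x, hxi, hxj⟩
      have hsub : X j ⊆ ⋃ m ≤ σ.symm j, X (σ m) := fun y hy =>
        Set.mem_iUnion₂.2 ⟨σ.symm j, le_rfl, by simpa using hy⟩
      obtain ⟨m, hm, hxm⟩ := Set.mem_iUnion₂.1 (closure_minimal hsub (hσ _) hxj)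
      have him : i = σ m := by
        by_contra h
        exact Set.disjoint_left.1 (hdisj h) hxi hxm
      exact lt_of_le_of_ne (by simpa [him] using hm) fun h => hij (σ.symm.injective h)
    have htrans : ∀ k, Relation.TransGen
        (fun i j => i ≠ j ∧ (X i ∩ closure (X j)).Nonempty) i k → σ.symm i < σ.symm k := by
      intro k hk
      induction hk with
      | single h => exact hlt _ _ h
      | tail _ h ih => exact ih.trans (hlt _ _ h)
    exact lt_irrefl _ (htrans i hi)
  · intro h
    obtain ⟨σ, hσ⟩ := exists_equiv_fin_lt_of_transGen_irrefl (Fintype.card_fin n) h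
    refine ⟨σ, fun j => isClosed_of_closure_subset fun x hx => ?_⟩
    change x ∈ closure (⋃ m ∈ Set.Iic j, X (σ m)) at hx
    rw [(Set.finite_Iic j).closure_biUnion] at hx
    obtain ⟨m, hm, hxm⟩ := Set.mem_iUnion₂.1 hx
    obtain ⟨k, hk⟩ := Set.mem_iUnion.1 (hcover ▸ Set.mem_univ x)
    refine Set.mem_iUnion₂.2 ⟨σ.symm k, ?_, by simpa using hk⟩
    by_cases hkm : k = σ m
    · simpa [hkm] using hm
    · have := hσ k (σ m) ⟨hkm, x, hk, hxm⟩
      rw [Equiv.symm_apply_apply] at this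
      exact this.le.trans hm
end

section
/- Let X and Y be topological spaces with locally closed decompositions X = X_1 ⊔ … ⊔ X_n and Y = Y_1 ⊔ … ⊔ Y_k (with n, k ≥ 1) in which every piece X_i and every piece Y_j is nonempty. Then the induced locally closed decomposition of the product space X × Y into the n·k pieces X_i × Y_j is filterable if and only if both the decomposition of X and the decomposition of Y are filterable. (Proposition 'filter_prod_gen'.) -/
/-- A finite decomposition `X : ι → Set α` of a topological space is *filterable* if the
pieces can be reordered (via a bijection with `Fin (Fintype.card ι)`) so that every
partial union is closed. -/
def IsFilterableDecomp {α ι : Type*} [TopologicalSpace α] [Fintype ι] (X : ι → Set α) : Prop :=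
  ∃ e : ι ≃ Fin (Fintype.card ι),
    ∀ j : Fin (Fintype.card ι), IsClosed (⋃ i, ⋃ (_ : e i ≤ j), X i)

/-- A decomposition is filterable iff its pieces can be ranked injectively so that the closure of
each piece only meets pieces of smaller or equal rank. -/
theorem isFilterableDecomp_iff_exists_injective {α ι : Type*} [TopologicalSpace α] [Fintype ι]
    {X : ι → Set α} (hdisj : Pairwise (Function.onFun Disjoint X)) (hcov : ⋃ i, X i = Set.univ) :
    IsFilterableDecomp X ↔ ∃ f : ι → ℕ, Function.Injective f ∧
      ∀ i j, (closure (X i) ∩ X j).Nonempty → f j ≤ f i := by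
  constructor
  · rintro ⟨e, he⟩
    refine ⟨fun i ↦ e i, Fin.val_injective.comp e.injective, ?_⟩
    rintro i j ⟨x, hxi, hxj⟩
    have hsub : X i ⊆ ⋃ l, ⋃ (_ : e l ≤ e i), X l :=
      Set.subset_iUnion₂_of_subset i le_rfl subset_rfl
    have hx := closure_minimal hsub (he (e i)) hxi
    obtain ⟨l, hl, hxl⟩ := Set.mem_iUnion₂.1 hx
    obtain rfl : l = j := hdisj.eq (Set.not_disjoint_iff.2 ⟨x, hxl, hxj⟩)
    exact hl
  · rintro ⟨f, hf, hfX⟩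
    let _ : LinearOrder ι := LinearOrder.lift' f hf
    let e : ι ≃o Fin (Fintype.card ι) := (Fintype.orderIsoFinOfCardEq ι rfl).symm
    refine ⟨e.toEquiv, fun m ↦ isClosed_of_closure_subset fun x hx ↦ ?_⟩
    simp only [closure_iUnion_of_finite] at hx
    obtain ⟨i, hi, hxi⟩ := Set.mem_iUnion₂.1 hx
    obtain ⟨j, hxj⟩ := Set.mem_iUnion.1 (hcov ▸ Set.mem_univ x)
    have hji : j ≤ i := hfX i j ⟨x, hxi, hxj⟩
    exact Set.mem_iUnion₂.2 ⟨j, (e.monotone hji).trans hi, hxj⟩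

/-- **Proposition (filter_prod_gen).**
Let `X` and `Y` be topological spaces with locally closed decompositions
`X = X 1 ⊔ … ⊔ X n` and `Y = Y 1 ⊔ … ⊔ Y k` (with `n, k ≥ 1`) into nonempty pieces.
Then the induced locally closed decomposition of `X × Y` into the `n·k` pieces
`X i ×ˢ Y j` is filterable iff both the decomposition of `X` and that of `Y` are. -/
theorem filter_prod_gen {α β : Type*} [TopologicalSpace α] [TopologicalSpace β]
    {n k : ℕ} (hn : 0 < n) (hk : 0 < k)
    (X : Fin n → Set α) (Y : Fin k → Set β)
    (hXne : ∀ i, (X i).Nonempty) (hYne : ∀ j, (Y j).Nonempty)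
    (hXdisj : Pairwise (Function.onFun Disjoint X))
    (hYdisj : Pairwise (Function.onFun Disjoint Y))
    (hXlc : ∀ i, IsLocallyClosed (X i)) (hYlc : ∀ j, IsLocallyClosed (Y j))
    (hXcov : ⋃ i, X i = Set.univ) (hYcov : ⋃ j, Y j = Set.univ) :
    IsFilterableDecomp (fun p : Fin n × Fin k => X p.1 ×ˢ Y p.2) ↔
      IsFilterableDecomp X ∧ IsFilterableDecomp Y := by
  have hdisj : Pairwise (Function.onFun Disjoint fun p : Fin n × Fin k ↦ X p.1 ×ˢ Y p.2) := by
    intro p q hpq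
    refine Set.disjoint_left.2 fun z hp hq ↦ hpq (Prod.ext ?_ ?_)
    · exact hXdisj.eq (Set.not_disjoint_iff.2 ⟨z.1, hp.1, hq.1⟩)
    · exact hYdisj.eq (Set.not_disjoint_iff.2 ⟨z.2, hp.2, hq.2⟩)
  have hcov : ⋃ p : Fin n × Fin k, X p.1 ×ˢ Y p.2 = Set.univ := by
    rw [Set.iUnion_prod X Y, hXcov, hYcov, Set.univ_prod_univ]
  rw [isFilterableDecomp_iff_exists_injective hdisj hcov,
    isFilterableDecomp_iff_exists_injective hXdisj hXcov,
    isFilterableDecomp_iff_exists_injective hYdisj hYcov]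
  simp only [closure_prod_eq, Set.prod_inter_prod, Set.prod_nonempty_iff]
  constructor
  · rintro ⟨f, hf, hfXY⟩
    let i₀ : Fin n := ⟨0, hn⟩
    let j₀ : Fin k := ⟨0, hk⟩
    refine ⟨⟨fun i ↦ f (i, j₀), hf.comp (Prod.mk_left_injective j₀), fun i i' h ↦ ?_⟩,
      ⟨fun j ↦ f (i₀, j), hf.comp (Prod.mk_right_injective i₀), fun j j' h ↦ ?_⟩⟩
    · exact hfXY (i, j₀) (i', j₀) ⟨h, (hYne j₀).mono fun y hy ↦ ⟨subset_closure hy, hy⟩⟩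
    · exact hfXY (i₀, j) (i₀, j') ⟨(hXne i₀).mono fun x hx ↦ ⟨subset_closure hx, hx⟩, h⟩
  · rintro ⟨⟨f, hf, hfX⟩, g, hg, hgY⟩
    refine ⟨fun p ↦ Nat.pair (f p.1) (g p.2), fun p q h ↦ ?_, fun p q h ↦ ?_⟩
    · obtain ⟨h₁, h₂⟩ := Nat.pair_eq_pair.1 h
      exact Prod.ext (hf h₁) (hg h₂)
    · have mono_left (b : ℕ) : StrictMono (Nat.pair · b) := fun _ _ ↦ Nat.pair_lt_pair_left b
      have mono_right (a : ℕ) : StrictMono (Nat.pair a) := fun _ _ ↦ Nat.pair_lt_pair_right a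
      exact ((mono_left _).monotone (hfX _ _ h.1)).trans ((mono_right _).monotone (hgY _ _ h.2))
end

section
/- Let k be an algebraically closed field and X a complete variety over k. Let X = X_1 ⊔ … ⊔ X_n be a partition of the underlying topological space of X into pairwise disjoint locally closed subsets such that each partial union X_1 ∪ … ∪ X_j is closed in X (the ordering filters X), and such that each X_i is an affine cell: there exist an integral affine scheme Z_i of finite type over k and an immersion Z_i ⟶ X inducing a homeomorphism of Z_i onto X_i. Then for every integer d with 0 ≤ d ≤ dim X there exists an index i such that dim X_i = d. (Proposition 'cells_of_every_dim', which repairs Białynicki-Birula's Proposition 4.7 in the filterable setting.) -/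
open AlgebraicGeometry

section

open CategoryTheory TopologicalSpace

universe u

theorem ringKrullDim_eq_of_isIntegral {R S : Type*} [CommRing R] [CommRing S] [Algebra R S]
    [Algebra.IsIntegral R S] (hinj : Function.Injective (algebraMap R S)) :
    ringKrullDim S = ringKrullDim R := by
  have hmono : StrictMono (PrimeSpectrum.comap (algebraMap R S)) := fun p q hpq =>
    Ideal.IsIntegral.comap_lt_comap (R := R) (I := p.asIdeal) (J := q.asIdeal) hpq
  have hlift : ∀ (a : PrimeSpectrum S) (b : PrimeSpectrum R),
      PrimeSpectrum.comap (algebraMap R S) a < b →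
        ∃ a', a < a' ∧ PrimeSpectrum.comap (algebraMap R S) a' = b := by
    intro a b hab
    obtain ⟨Q, hQ, hQp, hQc⟩ := Ideal.exists_ideal_over_prime_of_isIntegral_of_isPrime b.asIdeal
      a.asIdeal hab.le
    have hb : PrimeSpectrum.comap (algebraMap R S) ⟨Q, hQp⟩ = b := PrimeSpectrum.ext hQc
    refine ⟨⟨Q, hQp⟩, lt_of_le_of_ne hQ ?_, hb⟩
    rintro rfl
    exact hab.ne hb
  have hsurj : Function.Surjective (PrimeSpectrum.comap (algebraMap R S)) := by
    intro b
    obtain ⟨Q, -, hQp, hQc⟩ := Ideal.exists_ideal_over_prime_of_isIntegral b.asIdeal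
      (⊥ : Ideal S) (by rw [← RingHom.ker_eq_comap_bot,
        (RingHom.injective_iff_ker_eq_bot _).1 hinj]; exact bot_le)
    exact ⟨⟨Q, hQp⟩, PrimeSpectrum.ext hQc⟩
  have hco := Order.coheight_eq_of_strictMono _ hmono hlift
  unfold ringKrullDim
  rcases isEmpty_or_nonempty (PrimeSpectrum R) with hR | hR
  · have : IsEmpty (PrimeSpectrum S) := ⟨fun a => hR.elim (PrimeSpectrum.comap (algebraMap R S) a)⟩
    rw [Order.krullDim_eq_bot, Order.krullDim_eq_bot]
  · have : Nonempty (PrimeSpectrum S) := hR.map fun b => (hsurj b).choose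
    rw [Order.krullDim_eq_iSup_coheight_of_nonempty, Order.krullDim_eq_iSup_coheight_of_nonempty,
      ← hsurj.iSup_comp]
    simp only [hco]

/-- The ring homomorphism `c` out of a field `k` admits `m` algebraically independent elements. -/
def HasAlgIndep {k R : Type*} [Field k] [CommRing R] (c : k →+* R) (m : ℕ) : Prop :=
  ∃ v : Fin m → R, Function.Injective (MvPolynomial.eval₂Hom c v)

section
variable {k R S : Type*} [Field k] [CommRing R] [CommRing S]

theorem HasAlgIndep.map {c : k →+* R} {m : ℕ} (h : HasAlgIndep c m) (ψ : R →+* S)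
    (hψ : Function.Injective ψ) : HasAlgIndep (ψ.comp c) m := by
  obtain ⟨v, hv⟩ := h
  refine ⟨ψ ∘ v, ?_⟩
  have := hψ.comp hv
  rwa [← RingHom.coe_comp, MvPolynomial.comp_eval₂Hom] at this

theorem HasAlgIndep.mono {c : k →+* R} {m n : ℕ} (h : HasAlgIndep c n) (hmn : m ≤ n) :
    HasAlgIndep c m := by
  obtain ⟨v, hv⟩ := h
  refine ⟨v ∘ Fin.castLE hmn, ?_⟩
  have : MvPolynomial.eval₂Hom c (v ∘ Fin.castLE hmn) =
      (MvPolynomial.eval₂Hom c v).comp (MvPolynomial.rename (Fin.castLE hmn)).toRingHom := by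
    ext <;> simp
  rw [this]
  exact hv.comp (MvPolynomial.rename_injective _ (Fin.castLE_injective hmn))

theorem hasAlgIndep_algebraMap_iff [Algebra k R] {m : ℕ} :
    HasAlgIndep (algebraMap k R) m ↔ ∃ v : Fin m → R, AlgebraicIndependent k v := Iff.rfl

theorem HasAlgIndep.le_of_isAlgebraic {s m : ℕ} {K : Type*} [CommRing K] [IsDomain K]
    [Algebra (MvPolynomial (Fin s) k) K] [FaithfulSMul (MvPolynomial (Fin s) k) K]
    [Algebra k K] [IsScalarTower k (MvPolynomial (Fin s) k) K]
    [Algebra.IsAlgebraic (MvPolynomial (Fin s) k) K] (h : HasAlgIndep (algebraMap k K) m) :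
    m ≤ s := by
  obtain ⟨v, hv⟩ := hasAlgIndep_algebraMap_iff.1 h
  have h1 := hv.lift_cardinalMk_le_trdeg
  have h2 := lift_trdeg_add_eq k (MvPolynomial (Fin s) k) K
  rw [trdeg_eq_zero (R := MvPolynomial (Fin s) k) (A := K),
    MvPolynomial.trdeg_of_isDomain] at h2
  simp only [Cardinal.mk_fin, Cardinal.lift_natCast, Cardinal.lift_zero, add_zero] at h1 h2
  rw [Cardinal.lift_uzero] at h1
  have h3 := Cardinal.lift_le.2 h1
  rw [← h2] at h3
  simpa using h3

variable [Algebra k R] [Algebra.FiniteType k R]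

theorem hasAlgIndep_of_le_ringKrullDim [Nontrivial R] {d : ℕ}
    (hd : (d : WithBot ℕ∞) ≤ ringKrullDim R) :
    HasAlgIndep (algebraMap k R) d := by
  obtain ⟨s, g, hg, hgi⟩ := exists_integral_inj_algHom_of_fg k R
  algebraize [g.toRingHom]
  have := ringKrullDim_eq_of_isIntegral (R := MvPolynomial (Fin s) k) (S := R) hg
  rw [this, MvPolynomial.ringKrullDim_of_isNoetherianRing, ringKrullDim_eq_zero_of_field] at hd
  have hds : d ≤ s := by
    rw [zero_add, Nat.card_fin] at hd
    exact_mod_cast hd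
  refine HasAlgIndep.mono ⟨fun i => g (.X i), ?_⟩ hds
  have : MvPolynomial.eval₂Hom (algebraMap k R) (fun i => g (.X i)) = g.toRingHom := by
    ext <;> simp
  rw [this]
  exact hg

theorem HasAlgIndep.le_ringKrullDim [IsDomain R] {K : Type*} [Field K] [Algebra R K]
    [FaithfulSMul R K] [Algebra.IsAlgebraic R K] [Algebra k K] [IsScalarTower k R K] {d : ℕ}
    (h : HasAlgIndep (algebraMap k K) d) : (d : WithBot ℕ∞) ≤ ringKrullDim R := by
  obtain ⟨s, g, hg, hgi⟩ := exists_integral_inj_algHom_of_fg k R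
  algebraize [g.toRingHom, (algebraMap R K).comp g.toRingHom]
  have hk : IsScalarTower k (MvPolynomial (Fin s) k) K := by
    refine IsScalarTower.of_algebraMap_eq fun x => ?_
    rw [IsScalarTower.algebraMap_apply k R K]
    exact congr_arg (algebraMap R K) (g.commutes x).symm
  have : FaithfulSMul (MvPolynomial (Fin s) k) K :=
    (faithfulSMul_iff_algebraMap_injective _ _).2 ((FaithfulSMul.algebraMap_injective R K).comp hg)
  have : FaithfulSMul (MvPolynomial (Fin s) k) R :=
    (faithfulSMul_iff_algebraMap_injective _ _).2 hg
  have : Algebra.IsAlgebraic (MvPolynomial (Fin s) k) K :=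
    Algebra.IsAlgebraic.trans (MvPolynomial (Fin s) k) R K
  have hds := h.le_of_isAlgebraic (s := s)
  rw [ringKrullDim_eq_of_isIntegral (R := MvPolynomial (Fin s) k) (S := R) hg,
    MvPolynomial.ringKrullDim_of_isNoetherianRing, ringKrullDim_eq_zero_of_field]
  simpa using mod_cast hds
end

theorem MvPolynomial.hasAlgIndep_quotient_span_singleton {k : Type*} [Field k] {s n : ℕ}
    (hn : n + 1 ≤ s) {π : MvPolynomial (Fin s) k} (hπ : Irreducible π) :
    HasAlgIndep (algebraMap k (MvPolynomial (Fin s) k ⧸ Ideal.span {π})) n := by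
  obtain ⟨s, rfl⟩ : ∃ t, s = t + 1 := ⟨s - 1, by omega⟩
  refine HasAlgIndep.mono (n := s) ?_ (by omega)
  obtain ⟨i, hi⟩ : π.vars.Nonempty := by
    rw [Finset.nonempty_iff_ne_empty]
    intro h
    rw [vars_eq_empty_iff_eq_C] at h
    have h0 : π.coeff 0 ≠ 0 := fun h0 => hπ.ne_zero (by rw [h, h0, C_0])
    exact hπ.not_isUnit (h ▸ (isUnit_iff_ne_zero.2 h0).map C)
  refine ⟨fun j => Ideal.Quotient.mk _ (X (i.succAbove j)), ?_⟩
  have : eval₂Hom (algebraMap k (MvPolynomial (Fin (s + 1)) k ⧸ Ideal.span {π}))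
      (fun j => Ideal.Quotient.mk _ (X (i.succAbove j))) =
      (Ideal.Quotient.mk _).comp (rename i.succAbove).toRingHom := by
    ext
    · simp; rfl
    · simp
  rw [this, injective_iff_map_eq_zero]
  intro F hF
  by_contra hF0
  simp only [RingHom.comp_apply, Ideal.Quotient.eq_zero_iff_dvd] at hF
  obtain ⟨q, hq⟩ := hF
  have hr : rename i.succAbove F ≠ 0 := fun h =>
    hF0 (rename_injective _ i.succAbove_right_injective (by simpa using h))
  change rename i.succAbove F = _ at hq
  rw [hq] at hr
  have h1 := degreeOf_mul_eq (n := i) (left_ne_zero_of_mul hr) (right_ne_zero_of_mul hr)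
  rw [← hq] at h1
  have h2 : degreeOf i π ≠ 0 := mem_vars_iff_degreeOf_ne_zero.1 hi
  have h3 : degreeOf i (rename i.succAbove F) = 0 := by
    by_contra h
    obtain ⟨j, -, hj⟩ := mem_vars_rename _ _ (mem_vars_iff_degreeOf_ne_zero.2 h)
    exact i.succAbove_ne j hj
  omega

theorem isIntegral_of_forall_irreducible {P K : Type*} [CommRing P] [IsDomain P]
    [UniqueFactorizationMonoid P] [Field K] [Algebra P K] [FaithfulSMul P K] {h : K}
    (h0 : ∃ t : P, t ≠ 0 ∧ IsIntegral P (t • h))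
    (H : ∀ π : P, Irreducible π → ∃ t : P, ¬ π ∣ t ∧ IsIntegral P (t • h)) :
    IsIntegral P h := by
  let L := FractionRing P
  let : Algebra L K := FractionRing.liftAlgebra P K
  have hL : IsIntegral L h := by
    obtain ⟨t, ht, hi⟩ := h0
    have ht' : algebraMap P L t ≠ 0 := by simpa using ht
    have := (hi.tower_top (A := L)).smul (algebraMap P L t)⁻¹
    rwa [← algebraMap_smul L t h, smul_smul, inv_mul_cancel₀ ht', one_smul] at this
  have key : ∀ t : P, t ≠ 0 → IsIntegral P (t • h) → ∀ i, ∃ m, ∃ a : P,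
      (minpoly L h).coeff i * algebraMap P L t ^ m = algebraMap P L a := by
    intro t ht hi i
    have ht' : algebraMap P L t ≠ 0 := by simpa using ht
    have h1 := minpoly.isIntegrallyClosed_eq_field_fractions' L hi
    rw [← algebraMap_smul L t h, IsIntegrallyClosed.minpoly_smul ht' hL, algebraMap_smul] at h1
    refine ⟨(minpoly L h).natDegree - i, (minpoly P (t • h)).coeff i, ?_⟩
    rw [← Polynomial.coeff_map, ← h1, Polynomial.coeff_scaleRoots]
  have hc : ∀ i, IsLocalization.IsInteger P ((minpoly L h).coeff i) := by
    intro i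
    by_contra hn
    set c := (minpoly L h).coeff i
    have hden : ¬ IsUnit (IsFractionRing.den P c : P) :=
      fun hu => hn (IsFractionRing.isInteger_of_isUnit_den hu)
    obtain ⟨π, hπ, hd⟩ := WfDvdMonoid.exists_irreducible_factor hden
      (nonZeroDivisors.ne_zero (IsFractionRing.den P c).2)
    obtain ⟨t, ht, hi⟩ := H π hπ
    obtain ⟨m, a, ha⟩ := key t (by rintro rfl; simp at ht) hi i
    have hnum : c * algebraMap P L (IsFractionRing.den P c) =
        algebraMap P L (IsFractionRing.num P c) := by
      rw [IsFractionRing.num_mul_den_eq_num_iff_eq]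
    have e : IsFractionRing.num P c * t ^ m = a * IsFractionRing.den P c := by
      apply IsFractionRing.injective P L
      rw [map_mul, map_mul, map_pow, ← hnum, ← ha]
      ring
    have hdvd : π ∣ IsFractionRing.num P c * t ^ m := e ▸ Dvd.dvd.mul_left hd a
    rcases hπ.prime.dvd_or_dvd hdvd with h2 | h2
    · exact hπ.not_isUnit (IsFractionRing.num_den_reduced P c h2 hd)
    · exact ht (hπ.prime.dvd_of_dvd_pow h2)
  have hlift : minpoly L h ∈ Polynomial.lifts (algebraMap P L) :=
    (Polynomial.lifts_iff_coeff_lifts _).2 fun i => hc i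
  obtain ⟨q, hq, -, hm⟩ := Polynomial.lifts_and_natDegree_eq_and_monic hlift (minpoly.monic hL)
  refine ⟨q, hm, ?_⟩
  have := minpoly.aeval L h
  rwa [← hq, Polynomial.aeval_map_algebraMap] at this

theorem exists_valuationSubring_notMem {k K : Type*} [Field k] [Field K] [Algebra k K] {h : K}
    (hh : Transcendental k h) :
    ∃ V : ValuationSubring K, (∀ a : k, algebraMap k K a ∈ V) ∧ h ∉ V := by
  have hn : h ∉ (integralClosure k K).toSubring := fun hi => hh (IsIntegral.isAlgebraic hi)
  obtain ⟨V, hV, hV'⟩ := Subring.exists_le_valuationSubring_of_isIntegrallyClosedIn hn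
  exact ⟨V, fun a => hV ((integralClosure k K).algebraMap_mem a), hV'⟩

theorem isIntegral_of_forall_prime {k : Type*} [Field k] {s n : ℕ} (hn : n + 1 ≤ s) {B K : Type*}
    [CommRing B] [IsDomain B] [Field K] [Algebra k B] [Algebra (MvPolynomial (Fin s) k) B]
    [IsScalarTower k (MvPolynomial (Fin s) k) B] [FaithfulSMul (MvPolynomial (Fin s) k) B]
    [Algebra.IsIntegral (MvPolynomial (Fin s) k) B] [Algebra B K] [FaithfulSMul B K] {h : K}
    (H : ∀ p : Ideal B, p.IsPrime → (p = ⊥ ∨ HasAlgIndep (algebraMap k (B ⧸ p)) n) →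
      ∃ t ∉ p, ∃ b, algebraMap B K t * h = algebraMap B K b) : IsIntegral B h := by
  let P := MvPolynomial (Fin s) k
  algebraize [(algebraMap B K).comp (algebraMap P B)]
  have : FaithfulSMul P K := (faithfulSMul_iff_algebraMap_injective _ _).2
    ((FaithfulSMul.algebraMap_injective B K).comp (FaithfulSMul.algebraMap_injective P B))
  have hint : ∀ b : B, IsIntegral P (algebraMap B K b) := fun b =>
    (Algebra.IsIntegral.isIntegral (R := P) b).algebraMap
  let I : Ideal B :=
    { carrier := {t | ∃ b, algebraMap B K t * h = algebraMap B K b}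
      add_mem' := by
        rintro x y ⟨b, hb⟩ ⟨c, hc⟩
        exact ⟨b + c, by rw [map_add, map_add, add_mul, hb, hc]⟩
      zero_mem' := ⟨0, by simp⟩
      smul_mem' := by
        rintro c x ⟨b, hb⟩
        exact ⟨c * b, by rw [smul_eq_mul, map_mul, map_mul, mul_assoc, hb]⟩ }
  have hI : ∀ t : P, algebraMap P B t ∈ I → IsIntegral P (t • h) := by
    rintro t ⟨b, hb⟩
    rw [Algebra.smul_def, IsScalarTower.algebraMap_apply P B K, hb]
    exact hint b
  refine (isIntegral_of_forall_irreducible (P := P) (h := h) ?_ ?_).tower_top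
  · obtain ⟨t, ht, hb⟩ := H ⊥ Ideal.isPrime_bot (Or.inl rfl)
    have htI : t ∈ I := hb
    by_contra! hc
    have : I.comap (algebraMap P B) = ⊥ := by
      rw [eq_bot_iff]
      intro r hr
      by_contra hr0
      exact hc r hr0 (hI r hr)
    have hI0 : I = ⊥ := Ideal.eq_bot_of_comap_eq_bot this
    exact ht (hI0 ▸ htI)
  · intro π hπ
    by_contra! hc
    have hPp : (Ideal.span {π}).IsPrime := (Ideal.span_singleton_prime hπ.ne_zero).2 hπ.prime
    have hle : I.comap (algebraMap P B) ≤ Ideal.span {π} := by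
      intro r hr
      by_contra hr0
      rw [Ideal.mem_span_singleton] at hr0
      exact hc r hr0 (hI r hr)
    obtain ⟨Q, hIQ, hQ, hQc⟩ := Ideal.exists_ideal_over_prime_of_isIntegral _ I hle
    have hinj : Function.Injective (Ideal.quotientMap Q (algebraMap P B) hQc.ge) :=
      Ideal.quotientMap_injective' hQc.le
    obtain ⟨t, ht, htb⟩ := H Q hQ <| Or.inr <| by
      convert (MvPolynomial.hasAlgIndep_quotient_span_singleton hn hπ).map _ hinj using 1
      ext x
      change _ = Ideal.Quotient.mk Q (algebraMap P B (algebraMap k P x))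
      rw [← IsScalarTower.algebraMap_apply]
      rfl
    exact ht (hIQ htb)

theorem isIntegral_algebraMap_of_forall_prime {k A B K : Type*} [Field k] [CommRing A] [IsDomain A]
    [CommRing B] [IsDomain B] [Field K] [Algebra A K] [IsFractionRing A K] [Algebra k B]
    [Algebra.FiniteType k B] [Algebra B K] [FaithfulSMul B K] [Algebra k K] [IsScalarTower k B K]
    {n : ℕ} (hK : HasAlgIndep (algebraMap k K) (n + 1))
    (H : ∀ p : Ideal B, p.IsPrime → (p = ⊥ ∨ HasAlgIndep (algebraMap k (B ⧸ p)) n) →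
      ∀ a : A, ∃ t ∉ p, ∃ b, algebraMap B K t * algebraMap A K a = algebraMap B K b) (a : A) :
    IsIntegral B (algebraMap A K a) := by
  have hA : ∀ a : A, IsAlgebraic B (algebraMap A K a) := by
    intro a
    obtain ⟨t, ht, b, hb⟩ := H ⊥ Ideal.isPrime_bot (Or.inl rfl) a
    have ht0 : algebraMap B K t ≠ 0 := by simpa using ht
    rw [eq_div_of_mul_eq ht0 ((mul_comm _ _).trans hb), div_eq_mul_inv]
    exact (isAlgebraic_algebraMap b).mul (isAlgebraic_algebraMap t).inv
  have : Algebra.IsAlgebraic B K := ⟨fun x => by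
    obtain ⟨a, b, -, rfl⟩ := IsFractionRing.div_surjective (A := A) x
    exact div_eq_mul_inv (algebraMap A K a) _ ▸ (hA a).mul (hA b).inv⟩
  obtain ⟨s, g, hg, hgi⟩ := exists_integral_inj_algHom_of_fg k B
  algebraize [g.toRingHom, (algebraMap B K).comp g.toRingHom]
  have hkK : IsScalarTower k (MvPolynomial (Fin s) k) K := by
    refine IsScalarTower.of_algebraMap_eq fun x => ?_
    rw [IsScalarTower.algebraMap_apply k B K]
    exact congr_arg (algebraMap B K) (g.commutes x).symm
  have hkB : IsScalarTower k (MvPolynomial (Fin s) k) B :=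
    IsScalarTower.of_algebraMap_eq fun x => (g.commutes x).symm
  have : FaithfulSMul (MvPolynomial (Fin s) k) B :=
    (faithfulSMul_iff_algebraMap_injective _ _).2 hg
  have : FaithfulSMul (MvPolynomial (Fin s) k) K := (faithfulSMul_iff_algebraMap_injective _ _).2
    ((FaithfulSMul.algebraMap_injective B K).comp hg)
  have : Algebra.IsAlgebraic (MvPolynomial (Fin s) k) K :=
    Algebra.IsAlgebraic.trans (MvPolynomial (Fin s) k) B K
  exact isIntegral_of_forall_prime (hK.le_of_isAlgebraic (s := s)) fun p hp h => H p hp h a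

theorem HasAlgIndep.le_ringKrullDim_of_forall_eq_div {k R K : Type*} [Field k] [CommRing R]
    [Field K] {c : k →+* R} (hc : c.FiniteType) {φ : R →+* K} (hφ : ∀ x, ∃ a b, x = φ a / φ b)
    {d : ℕ} (h : HasAlgIndep (φ.comp c) d) : (d : WithBot ℕ∞) ≤ ringKrullDim R := by
  algebraize [c, φ, φ.comp c]
  let ψ := IsScalarTower.toAlgHom k R K
  have : Algebra.FiniteType k ψ.range :=
    Algebra.FiniteType.of_surjective ψ.rangeRestrict ψ.rangeRestrict_surjective
  have : Algebra.IsAlgebraic ψ.range K := ⟨fun x => by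
    obtain ⟨a, b, rfl⟩ := hφ x
    rw [div_eq_mul_inv]
    exact (isAlgebraic_algebraMap (ψ.rangeRestrict a)).mul
      (isAlgebraic_algebraMap (ψ.rangeRestrict b)).inv⟩
  exact (HasAlgIndep.le_ringKrullDim (R := ψ.range) (K := K) h).trans
    (ringKrullDim_le_of_surjective ψ.rangeRestrict.toRingHom ψ.rangeRestrict_surjective)

theorem HasAlgIndep.of_surjective {k R S T : Type*} [Field k] [CommRing R] [CommRing S]
    [CommRing T] {c : k →+* R} {φ : R →+* S} {m : ℕ} (h : HasAlgIndep (φ.comp c) m)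
    (hφ : Function.Surjective φ) {ψ : R →+* T} (hψ : ∀ r, ψ r = 0 → φ r = 0) :
    HasAlgIndep (ψ.comp c) m := by
  obtain ⟨v, hv⟩ := h
  choose w hw using fun i => hφ (v i)
  obtain rfl : φ ∘ w = v := funext hw
  refine ⟨ψ ∘ w, ?_⟩
  have hw : ∀ F, φ (MvPolynomial.eval₂Hom c w F) =
      MvPolynomial.eval₂Hom (φ.comp c) (φ ∘ w) F :=
    RingHom.congr_fun (MvPolynomial.comp_eval₂Hom c w φ)
  have hw' : ∀ F, ψ (MvPolynomial.eval₂Hom c w F) =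
      MvPolynomial.eval₂Hom (ψ.comp c) (ψ ∘ w) F :=
    RingHom.congr_fun (MvPolynomial.comp_eval₂Hom c w ψ)
  rw [injective_iff_map_eq_zero] at hv ⊢
  intro F hF
  exact hv F (by rw [← hw, hψ _ (by rw [hw', hF])])

theorem HasAlgIndep.exists_valuationSubring {k R K : Type*} [Field k] [CommRing R] [Field K]
    {c : k →+* R} {m : ℕ} (h : HasAlgIndep c (m + 1)) {φ : R →+* K} (hφ : Function.Injective φ) :
    ∃ (V : ValuationSubring K) (a : R), (∀ x, φ (c x) ∈ V) ∧ φ a ∉ V := by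
  algebraize [c, φ, φ.comp c]
  obtain ⟨v, hv⟩ := hasAlgIndep_algebraMap_iff.1 h
  have ht : Transcendental k (algebraMap R K (v 0)) :=
    (transcendental_algebraMap_iff hφ).2 (hv.transcendental 0)
  obtain ⟨V, hV, hV'⟩ := exists_valuationSubring_notMem ht
  exact ⟨V, v 0, hV, hV'⟩

theorem algebraMap_mem_valuationSubring_of_forall_prime {k R A K : Type*} [Field k] [CommRing R]
    [CommRing A] [IsDomain A] [Field K] [Algebra A K] [IsFractionRing A K] {c : k →+* R}
    (hc : c.FiniteType) {σ : R →+* K} {n : ℕ} (hK : HasAlgIndep (σ.comp c) (n + 1))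
    {V : ValuationSubring K} (hV : ∀ r, σ r ∈ V)
    (H : ∀ q : Ideal R, q.IsPrime → RingHom.ker σ ≤ q →
      (q = RingHom.ker σ ∨ HasAlgIndep ((Ideal.Quotient.mk q).comp c) n) →
      ∀ a : A, ∃ s ∉ q, ∃ r, σ s * algebraMap A K a = σ r) (a : A) :
    algebraMap A K a ∈ V := by
  let : Algebra k K := (σ.comp c).toAlgebra
  let : Algebra k σ.range := (σ.rangeRestrict.comp c).toAlgebra
  have : IsScalarTower k σ.range K := .of_algebraMap_eq fun _ => rfl
  have : Algebra.FiniteType k σ.range :=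
    RingHom.FiniteType.comp_surjective hc σ.rangeRestrict_surjective
  have hint := isIntegral_algebraMap_of_forall_prime (B := σ.range) (A := A) (K := K) (n := n) hK
    (fun p hp h a => by
      have hker : RingHom.ker σ.rangeRestrict = RingHom.ker σ := σ.ker_rangeRestrict
      obtain ⟨s, hs, r, hr⟩ := H (p.comap σ.rangeRestrict) (hp.comap _)
        (hker ▸ Ideal.ker_le_comap _) (h.imp (fun h => by rw [h, ← hker]; rfl) fun h =>
          HasAlgIndep.of_surjective (φ := (Ideal.Quotient.mk p).comp σ.rangeRestrict) h
            (Ideal.Quotient.mk_surjective.comp σ.rangeRestrict_surjective) fun r hr =>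
              Ideal.Quotient.eq_zero_iff_mem.2 (Ideal.Quotient.eq_zero_iff_mem.1 hr :)) a
      exact ⟨σ.rangeRestrict s, hs, σ.rangeRestrict r, hr⟩) a
  let : Algebra σ.range V := (Subring.inclusion (T := V.toSubring) (by
    rintro _ ⟨r, rfl⟩; exact hV r)).toAlgebra
  have : IsScalarTower σ.range V K := .of_algebraMap_eq fun _ => rfl
  obtain ⟨v, hv⟩ := IsIntegrallyClosed.isIntegral_iff.1 (hint.tower_top (A := V))
  exact hv ▸ v.2

theorem exists_mul_germToFunctionField_eq {X Z : Scheme.{u}} [IsIntegral Z] (g : Z ⟶ X)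
    [SurjectiveOnStalks g] {W : X.Opens} (hW : IsAffineOpen W) {σ : Γ(X, W) ⟶ Z.functionField}
    (hσ : Spec.map σ ≫ hW.fromSpec = Z.fromSpecStalk (genericPoint Z) ≫ g) {z : Z} (hz : g z ∈ W)
    {U : Z.Opens} [Nonempty U] (hU : z ∈ U) (a : Γ(Z, U)) :
    ∃ r s : Γ(X, W), g z ∈ X.basicOpen s ∧ σ s * Z.germToFunctionField U a = σ r := by
  have hsp : genericPoint Z ⤳ z := (genericPoint_spec Z).specializes trivial
  have hσ' : σ = X.presheaf.germ W (g z) hz ≫ g.stalkMap z ≫ Z.presheaf.stalkSpecializes hsp := by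
    apply Spec.map_injective
    rw [← cancel_mono hW.fromSpec, hσ, Spec.map_comp, Spec.map_comp, Category.assoc, Category.assoc]
    change _ = _ ≫ _ ≫ hW.fromSpecStalk hz
    rw [hW.fromSpecStalk_eq_fromSpecStalk hz, Scheme.SpecMap_stalkMap_fromSpecStalk,
      Scheme.SpecMap_stalkSpecializes_fromSpecStalk_assoc]
  obtain ⟨v, hv⟩ := g.stalkMap_surjective z (Z.presheaf.germ U z hU a)
  let : Algebra Γ(X, W) (X.presheaf.stalk (g z)) :=
    TopCat.Presheaf.algebra_section_stalk X.presheaf (⟨g z, hz⟩ : W)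
  have := hW.isLocalization_stalk ⟨g z, hz⟩
  obtain ⟨⟨r, s⟩, hrs⟩ := IsLocalization.surj (hW.primeIdealOf ⟨g z, hz⟩).asIdeal.primeCompl v
  refine ⟨r, s, (X.mem_basicOpen _ _ hz).2
    (IsLocalization.map_units (X.presheaf.stalk (g z)) s), ?_⟩
  have h1 := congr_arg (fun w => Z.presheaf.stalkSpecializes hsp (g.stalkMap z w)) hrs
  simp only [map_mul, hv] at h1
  rw [hσ', mul_comm]
  convert h1 using 2
  · rw [← ConcreteCategory.comp_apply, TopCat.Presheaf.germ_stalkSpecializes]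
  · rfl
  · rfl

theorem isAffine_topologicalKrullDim_eq (X : Scheme.{u}) [IsAffine X] :
    topologicalKrullDim X = ringKrullDim Γ(X, ⊤) := by
  rw [← PrimeSpectrum.topologicalKrullDim_eq_ringKrullDim]
  exact IsHomeomorph.topologicalKrullDim_eq _ X.isoSpec.hom.homeomorph.isHomeomorph

theorem IsAffineOpen.finiteType_preimage_fromSpec_comp {X : Scheme.{u}} {R : CommRingCat.{u}}
    (f : X ⟶ Spec R) [LocallyOfFiniteType f] {W : X.Opens} (hW : IsAffineOpen W) :
    (Spec.preimage (hW.fromSpec ≫ f)).hom.FiniteType := by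
  rw [← HasRingHomProperty.Spec_iff (P := @LocallyOfFiniteType), Spec.map_preimage]
  infer_instance

theorem UniversallyClosed.exists_isAffineOpen_of_valuationSubring {X S : Scheme.{u}} (f : X ⟶ S)
    [UniversallyClosed f] {K : Type u} [Field K] (V : ValuationSubring K)
    (i₁ : Spec (.of K) ⟶ X) (i₂ : Spec (.of V) ⟶ S)
    (h : i₁ ≫ f = Spec.map (CommRingCat.ofHom (algebraMap V K)) ≫ i₂) :
    ∃ (W : X.Opens) (hW : IsAffineOpen W) (σ : Γ(X, W) ⟶ .of K),
      (∀ r, σ r ∈ V) ∧ Spec.map σ ≫ hW.fromSpec = i₁ := by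
  have hf : ValuativeCriterion.Existence f := by
    have : (ValuativeCriterion.Existence ⊓ @QuasiCompact) f := by
      rw [← UniversallyClosed.eq_valuativeCriterion]
      infer_instance
    exact this.1
  obtain ⟨⟨ℓ, hℓ₁, -⟩⟩ := hf { R := V, K := K, i₁ := i₁, i₂ := i₂, commSq := ⟨h⟩ }
  obtain ⟨_, ⟨W, hW, rfl⟩, hxW, -⟩ := X.isBasis_affineOpens.exists_subset_of_mem_open
    (Set.mem_univ (ℓ (IsLocalRing.closedPoint V))) isOpen_univ
  have hW : IsAffineOpen W := hW
  have htop : ℓ ⁻¹ᵁ W = ⊤ := (IsLocalRing.closedPoint_mem_iff (R := V) (ℓ ⁻¹ᵁ W)).1 hxW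
  have hrange : Set.range ℓ ⊆ Set.range hW.fromSpec := by
    rw [hW.range_fromSpec]
    rintro _ ⟨y, rfl⟩
    exact (htop.ge trivial : y ∈ ℓ ⁻¹ᵁ W)
  let ρ := Spec.preimage (IsOpenImmersion.lift hW.fromSpec ℓ hrange)
  refine ⟨W, hW, ρ ≫ CommRingCat.ofHom (algebraMap V K), fun r => (ρ r).2, ?_⟩
  rw [Spec.map_comp, Category.assoc, Spec.map_preimage, IsOpenImmersion.lift_fac, hℓ₁]

theorem IsAffineOpen.fromSpec_mem_basicOpen_iff {X : Scheme.{u}} {W : X.Opens}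
    (hW : IsAffineOpen W) (q : PrimeSpectrum Γ(X, W)) (r : Γ(X, W)) :
    hW.fromSpec q ∈ X.basicOpen r ↔ r ∉ q.asIdeal := by
  change q ∈ hW.fromSpec ⁻¹ᵁ X.basicOpen r ↔ _
  rw [hW.fromSpec_preimage_basicOpen]
  rfl

/-- The residue field of `X` at `x` has transcendence degree at least `m` over the base field. -/
def HasTrdeg {k : Type u} [Field k] {X : Scheme.{u}} (f : X ⟶ Spec (CommRingCat.of k)) (x : X)
    (m : ℕ) : Prop :=
  HasAlgIndep (Spec.preimage (X.fromSpecResidueField x ≫ f)).hom m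

section
variable {k : Type u} [Field k] {X : Scheme.{u}} {f : X ⟶ Spec (CommRingCat.of k)}

theorem hasTrdeg_iff {W : X.Opens} (hW : IsAffineOpen W) {y : X} (hy : y ∈ W) {m : ℕ} :
    HasTrdeg f y m ↔ HasAlgIndep ((X.evaluation W y hy).hom.comp
      (Spec.preimage (hW.fromSpec ≫ f)).hom) m := by
  have : Spec.preimage (X.fromSpecResidueField y ≫ f) =
      Spec.preimage (hW.fromSpec ≫ f) ≫ X.evaluation W y hy := by
    apply Spec.map_injective
    rw [Spec.map_preimage, Spec.map_comp, Spec.map_preimage, Scheme.evaluation,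
      Scheme.fromSpecResidueField, ← hW.fromSpecStalk_eq_fromSpecStalk hy,
      IsAffineOpen.fromSpecStalk]
    simp
  rw [HasTrdeg, this]
  rfl

theorem HasTrdeg.of_comp {Z : Scheme.{u}} {g : Z ⟶ X} {z : Z} {m : ℕ} (h : HasTrdeg f (g z) m) :
    HasTrdeg (g ≫ f) z m := by
  have := h.map (g.residueFieldMap z).hom (RingHom.injective _)
  rw [← CommRingCat.hom_comp] at this
  unfold HasTrdeg
  convert this
  apply Spec.map_injective
  rw [Spec.map_preimage, Spec.map_comp, Spec.map_preimage]
  simp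

theorem HasTrdeg.le_topologicalKrullDim [LocallyOfFiniteType f] [IsAffine X] {x : X} {m : ℕ}
    (h : HasTrdeg f x m) : (m : WithBot ℕ∞) ≤ topologicalKrullDim X := by
  have hX := isAffineOpen_top X
  rw [hasTrdeg_iff hX trivial] at h
  have hft := IsAffineOpen.finiteType_preimage_fromSpec_comp f hX
  rw [isAffine_topologicalKrullDim_eq]
  refine h.le_ringKrullDim_of_forall_eq_div hft fun y => ?_
  obtain ⟨v, rfl⟩ := X.residue_surjective x y
  let : Algebra Γ(X, ⊤) (X.presheaf.stalk x) :=
    TopCat.Presheaf.algebra_section_stalk X.presheaf (⟨x, trivial⟩ : (⊤ : X.Opens))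
  have := hX.isLocalization_stalk ⟨x, trivial⟩
  obtain ⟨⟨r, s⟩, hrs⟩ := IsLocalization.surj (hX.primeIdealOf ⟨x, trivial⟩).asIdeal.primeCompl v
  have hs := (IsLocalization.map_units (X.presheaf.stalk x) s).map (X.residue x).hom
  refine ⟨r, s, eq_div_of_mul_eq hs.ne_zero ?_⟩
  have := congr_arg (X.residue x) hrs
  rwa [map_mul] at this
end

/-- A complete scheme contains, in the boundary of an integral affine immersed subscheme of
dimension at least `n + 1`, a point whose residue field has transcendence degree at least `n`. -/
theorem exists_hasTrdeg_mem_closure_diff_range {k : Type u} [Field k] {X : Scheme.{u}}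
    (f : X ⟶ Spec (CommRingCat.of k)) [LocallyOfFiniteType f] [UniversallyClosed f]
    {Z : Scheme.{u}} [IsAffine Z] [IsIntegral Z] (g : Z ⟶ X) [IsImmersion g] {n : ℕ}
    (hn : ((n + 1 : ℕ) : WithBot ℕ∞) ≤ topologicalKrullDim Z) :
    ∃ y ∈ closure (Set.range g), y ∉ Set.range g ∧ HasTrdeg f y n := by
  by_contra! H
  have hZ := isAffineOpen_top Z
  have : Nonempty (⊤ : Z.Opens) := ⟨⟨genericPoint Z, trivial⟩⟩
  have hfrac := functionField_isFractionRing_of_isAffineOpen Z ⊤ hZ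
  have hιinj := Z.germToFunctionField_injective ⊤
  set cA := Spec.preimage (hZ.fromSpec ≫ g ≫ f) with hcA
  have hind : HasAlgIndep cA.hom (n + 1) := by
    have hft := IsAffineOpen.finiteType_preimage_fromSpec_comp (g ≫ f) hZ
    rw [← hcA] at hft
    algebraize [cA.hom]
    rw [isAffine_topologicalKrullDim_eq] at hn
    exact hasAlgIndep_of_le_ringKrullDim hn
  obtain ⟨V, a₀, hkV, ha₀⟩ := hind.exists_valuationSubring
    (φ := (Z.germToFunctionField ⊤).hom) hιinj
  have hgen : Spec.map (Z.germToFunctionField ⊤) ≫ hZ.fromSpec =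
      Z.fromSpecStalk (genericPoint Z) := hZ.fromSpecStalk_eq_fromSpecStalk _
  let cV : k →+* V := ((Z.germToFunctionField ⊤).hom.comp cA.hom).codRestrict V hkV
  obtain ⟨W, hW, σ, hσV, hσ⟩ := UniversallyClosed.exists_isAffineOpen_of_valuationSubring f V
    (Z.fromSpecStalk (genericPoint Z) ≫ g) (Spec.map (CommRingCat.ofHom cV)) <| by
      rw [← Spec.map_comp, ← hgen, Category.assoc, Category.assoc,
        ← Spec.map_preimage (hZ.fromSpec ≫ g ≫ f), ← Spec.map_comp]
      rfl
  set cW := Spec.preimage (hW.fromSpec ≫ f) with hcW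
  have hc : cW ≫ σ = cA ≫ Z.germToFunctionField ⊤ := by
    apply Spec.map_injective
    rw [Spec.map_comp, Spec.map_comp, Spec.map_preimage, Spec.map_preimage, reassoc_of% hσ,
      reassoc_of% hgen]
  refine ha₀ (algebraMap_mem_valuationSubring_of_forall_prime (c := cW.hom) (σ := σ.hom) (n := n)
    (IsAffineOpen.finiteType_preimage_fromSpec_comp f hW) ?_ hσV (fun q hq hle h a => ?_) a₀)
  · have := hind.map _ hιinj
    rwa [← CommRingCat.hom_comp, ← hc] at this
  let y : X := hW.fromSpec ⟨q, hq⟩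
  have hy : y ∈ W := hW.range_fromSpec.le ⟨_, rfl⟩
  have hσy : hW.fromSpec ⟨RingHom.ker σ.hom, RingHom.ker_isPrime _⟩ ∈ Set.range g := by
    let o : Spec (.of Z.functionField) := (⊥ : PrimeSpectrum Z.functionField)
    have : (Spec.map σ ≫ hW.fromSpec) o = (Z.fromSpecStalk (genericPoint Z) ≫ g) o := by rw [hσ]
    exact ⟨_, this.symm⟩
  have hyr : y ∈ Set.range g := by
    obtain rfl | h := h
    · exact hσy
    by_contra hyr
    refine H y ?_ hyr ((hasTrdeg_iff hW hy).2 (h.of_surjective Ideal.Quotient.mk_surjective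
      fun r hr => ?_))
    · have hs : hW.fromSpec ⟨RingHom.ker σ.hom, RingHom.ker_isPrime _⟩ ⤳ y :=
        ((PrimeSpectrum.le_iff_specializes _ _).1 hle).map hW.fromSpec.continuous
      exact hs.mem_closed isClosed_closure (subset_closure hσy)
    · have := (Scheme.evaluation_eq_zero_iff_notMem_basicOpen (X := X) (U := W) y hy r).1 hr
      rw [IsAffineOpen.fromSpec_mem_basicOpen_iff hW, not_not] at this
      exact Ideal.Quotient.eq_zero_iff_mem.2 this
  obtain ⟨z, hz⟩ := hyr
  obtain ⟨r, s, hs, hrs⟩ := exists_mul_germToFunctionField_eq g hW hσ (hz ▸ hy)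
    (U := ⊤) (z := z) trivial a
  rw [hz, IsAffineOpen.fromSpec_mem_basicOpen_iff hW] at hs
  exact ⟨s, hs, r, hrs⟩

theorem exists_forall_natCast_le_topologicalKrullDim_opens {X : Type*} [TopologicalSpace X] {d : ℕ}
    (hd : (d : WithBot ℕ∞) ≤ topologicalKrullDim X) :
    ∃ x : X, ∀ U : Opens X, x ∈ U → (d : WithBot ℕ∞) ≤ topologicalKrullDim U := by
  obtain ⟨l, rfl⟩ := Order.le_krullDim_iff.1 hd
  obtain ⟨x, hx⟩ := l.head.isIrreducible.nonempty
  refine ⟨x, fun U hU => Order.le_krullDim_iff.2 ⟨.mk l.length (fun i =>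
    (IrreducibleCloseds.orderIsoOfIsOpenEmbedding ((↑) : U → X)
      U.isOpen.isOpenEmbedding_subtypeVal).symm
      ⟨l i, ⟨⟨x, hU⟩, SetLike.coe_subset_coe.2 (l.head_le i) hx⟩⟩) fun i j hij => ?_, rfl⟩⟩
  exact (OrderIso.lt_iff_lt _).2 (l.strictMono hij)

theorem hasTrdeg_genericPoint {k : Type u} [Field k] {X : Scheme.{u}}
    (f : X ⟶ Spec (CommRingCat.of k)) [LocallyOfFiniteType f] [IsIntegral X] {d : ℕ}
    (hd : (d : WithBot ℕ∞) ≤ topologicalKrullDim X) : HasTrdeg f (genericPoint X) d := by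
  obtain ⟨x, hx⟩ := exists_forall_natCast_le_topologicalKrullDim_opens hd
  obtain ⟨_, ⟨W, hW, rfl⟩, hxW, -⟩ := X.isBasis_affineOpens.exists_subset_of_mem_open
    (Set.mem_univ x) isOpen_univ
  have hW : IsAffineOpen W := hW
  have : Nonempty W := ⟨⟨x, hxW⟩⟩
  have hξ {V : X.Opens} (hV : (V : Set X).Nonempty) : genericPoint X ∈ V :=
    ((genericPoint_spec X).mem_open_set_iff V.isOpen).2 (by simpa using hV)
  have hft := IsAffineOpen.finiteType_preimage_fromSpec_comp f hW
  have hdim : topologicalKrullDim W = ringKrullDim Γ(X, W) := by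
    rw [← PrimeSpectrum.topologicalKrullDim_eq_ringKrullDim]
    exact IsHomeomorph.topologicalKrullDim_eq _ hW.isoSpec.hom.homeomorph.isHomeomorph
  have hdW := (hx W hxW).trans hdim.le
  rw [hasTrdeg_iff hW (hξ ⟨x, hxW⟩)]
  refine HasAlgIndep.map ?_ _ ?_
  · algebraize [(Spec.preimage (hW.fromSpec ≫ f)).hom]
    exact hasAlgIndep_of_le_ringKrullDim hdW
  · rw [injective_iff_map_eq_zero]
    intro r hr
    have := (Scheme.evaluation_eq_zero_iff_notMem_basicOpen (X := X) (U := W) _ _ r).1 hr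
    by_contra hr0
    refine this (hξ ?_)
    rwa [← Opens.ne_bot_iff_nonempty, ne_eq, basicOpen_eq_bot_iff]

end

/-- **Proposition (cells_of_every_dim).**
Let `k` be an algebraically closed field and `X` a complete variety over `k` (an integral
separated scheme of finite type over `k` whose structure morphism is universally closed).
Let `X = S 1 ⊔ … ⊔ S n` be a partition of the underlying space of `X` into pairwise
disjoint locally closed subsets such that each partial union `S 1 ∪ … ∪ S j` is closed
(the ordering filters `X`), and such that each `S i` is an affine cell: the homeomorphic
image, under an immersion `Z ⟶ X`, of an integral affine scheme `Z` of finite type over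
`k`.  Then for every `d` with `0 ≤ d ≤ dim X` there is an index `i` with `dim (S i) = d`
(topological Krull dimensions). -/
theorem cells_of_every_dim {k : Type u} [Field k] [IsAlgClosed k]
    (X : Scheme.{u}) (f : X ⟶ Spec (CommRingCat.of k))
    [IsIntegral X] [AlgebraicGeometry.IsSeparated f]
    [LocallyOfFiniteType f] [QuasiCompact f] [UniversallyClosed f]
    {n : ℕ} (S : Fin n → Set X)
    (hdisj : Pairwise (Function.onFun Disjoint S))
    (hlc : ∀ i, IsLocallyClosed (S i))
    (hcov : ⋃ i, S i = Set.univ)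
    (hfilt : ∀ j : Fin n, IsClosed (⋃ i ≤ j, S i))
    (hcell : ∀ i, ∃ (Z : Scheme.{u}) (g : Z ⟶ X) (h : Z ⟶ Spec (CommRingCat.of k)),
      IsAffine Z ∧ IsIntegral Z ∧ LocallyOfFiniteType h ∧ QuasiCompact h ∧
        IsImmersion g ∧ Set.range g.base = S i) :
    ∀ d : ℕ, (d : WithBot ℕ∞) ≤ topologicalKrullDim X →
      ∃ i, topologicalKrullDim (S i) = (d : WithBot ℕ∞) := by
  intro d hd
  choose Z g _ hZ hZ' _ _ hg hgS using hcell
  have hgS i : Set.range (g i) = S i := hgS i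
  have hdim i : topologicalKrullDim (Z i) = topologicalKrullDim (S i) := by
    rw [← hgS i]
    exact IsHomeomorph.topologicalKrullDim_eq _ (g i).isEmbedding.toHomeomorph.isHomeomorph
  have hmem : ∀ {i x}, x ∈ S i → HasTrdeg f x d → (d : WithBot ℕ∞) ≤ topologicalKrullDim (S i) := by
    intro i x hx h
    rw [← hgS i] at hx
    obtain ⟨z, rfl⟩ := hx
    exact hdim i ▸ h.of_comp.le_topologicalKrullDim
  have hne : ∃ i, (d : WithBot ℕ∞) ≤ topologicalKrullDim (S i) := by
    obtain ⟨i, hi⟩ := Set.mem_iUnion.1 (hcov.ge (Set.mem_univ (genericPoint X)))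
    exact ⟨i, hmem hi (hasTrdeg_genericPoint f hd)⟩
  obtain ⟨j, hj, hmin⟩ := WellFounded.has_min (wellFounded_lt (α := Fin n))
    {i | (d : WithBot ℕ∞) ≤ topologicalKrullDim (S i)} hne
  refine ⟨j, (eq_of_le_of_not_lt hj fun hlt => ?_).symm⟩
  obtain ⟨y, hy, hyj, hyd⟩ := exists_hasTrdeg_mem_closure_diff_range f (g j) (n := d) <| by
    rw [hdim]
    exact_mod_cast ENat.WithBot.add_one_le_iff.2 hlt
  rw [hgS] at hy hyj
  have hyle := (hfilt j).closure_subset_iff.2 (Set.subset_biUnion_of_mem (u := S) (le_refl j)) hy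
  obtain ⟨i, hij, hi⟩ := Set.mem_iUnion₂.1 hyle
  exact hmin i (hmem hi hyd) (hij.lt_of_ne fun h => hyj (h ▸ hi))
end

section
/- Let k be an algebraically closed field and X a complete variety over k. Suppose X admits a partition X = X_1 ⊔ … ⊔ X_n of its underlying topological space into pairwise disjoint locally closed subsets such that each partial union X_1 ∪ … ∪ X_j is closed in X, and such that each X_i is an affine cell: there exist an integral affine scheme Z_i of finite type over k and an immersion Z_i ⟶ X inducing a homeomorphism of Z_i onto X_i. Then n ≥ dim X + 1. (This is the cell-counting content of the Corollary following Proposition 'cells_of_every_dim', which repairs Białynicki-Birula's Corollary 1 in the filterable setting.) -/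
open AlgebraicGeometry

section Algebra

open Polynomial in
theorem IsIntegral.of_smul_prime {R S : Type*} [CommRing R] [IsDomain R] [IsIntegrallyClosed R]
    [CommRing S] [IsDomain S] [Algebra R S] [Module.IsTorsionFree R S] {π d : R} {z : S}
    (hπ : Prime π) (hd : ¬ π ∣ d) (h₁ : IsIntegral R (π • z)) (h₂ : IsIntegral R (d • z)) :
    IsIntegral R z := by
  have hd0 : d ≠ 0 := fun h ↦ hd (h ▸ dvd_zero π)
  have key : (minpoly R (π • z)).scaleRoots d = (minpoly R (d • z)).scaleRoots π := by
    rw [← IsIntegrallyClosed.minpoly_smul hd0 h₁, ← IsIntegrallyClosed.minpoly_smul hπ.ne_zero h₂,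
      smul_comm]
  set p := minpoly R (π • z) with hp
  set n := p.natDegree with hn
  have hdeg : (minpoly R (d • z)).natDegree = n := by
    rw [hn, ← natDegree_scaleRoots p d, key, natDegree_scaleRoots]
  have hdvd (i : ℕ) : π ^ (n - i) ∣ p.coeff i := by
    have h := congrArg (coeff · i) key
    simp only [coeff_scaleRoots, hdeg, ← hn] at h
    have : π ^ (n - i) ∣ p.coeff i * d ^ (n - i) := h ▸ dvd_mul_left _ _
    exact hπ.pow_dvd_of_dvd_mul_right _ (fun h ↦ hd (hπ.dvd_of_dvd_pow h)) this
  choose c hc using hdvd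
  have hcn : c n = 1 := by
    have := hc n
    rw [Nat.sub_self, pow_zero, one_mul, hn, (minpoly.monic h₁).coeff_natDegree] at this
    exact this.symm
  refine ⟨∑ i ∈ Finset.range (n + 1), C (c i) * X ^ i, ?_, ?_⟩
  · rw [Finset.sum_range_succ, hcn, C_1, one_mul, add_comm]
    refine monic_X_pow_add ((degree_sum_le _ _).trans_lt ?_)
    refine (Finset.sup_lt_iff (WithBot.bot_lt_coe n)).mpr fun i hi ↦ ?_
    exact (degree_C_mul_X_pow_le _ _).trans_lt
      (WithBot.coe_lt_coe.mpr (Finset.mem_range.mp hi))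
  · have h0 : aeval (π • z) p = 0 := minpoly.aeval R _
    have hne : algebraMap R S (π ^ n) ≠ 0 := by
      simpa using fun h ↦ absurd h hπ.ne_zero
    refine (mul_eq_zero.mp ?_).resolve_left hne
    rw [← h0, aeval_eq_sum_range, ← hn, eval₂_finsetSum, Finset.mul_sum]
    refine Finset.sum_congr rfl fun i hi ↦ ?_
    have hi' : i ≤ n := Nat.lt_succ_iff.mp (Finset.mem_range.mp hi)
    rw [hc i, _root_.smul_pow, eval₂_mul, eval₂_C, eval₂_pow, eval₂_X, Algebra.smul_def,
      Algebra.smul_def]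
    conv_lhs => rw [← Nat.sub_add_cancel hi', pow_add]
    simp only [map_mul, map_pow]
    ring

theorem IsIntegral.of_forall_prime {R S : Type*} [CommRing R] [IsDomain R]
    [UniqueFactorizationMonoid R] [CommRing S] [IsDomain S] [Algebra R S]
    [Module.IsTorsionFree R S] {x : S} (h₀ : ∃ d : R, d ≠ 0 ∧ IsIntegral R (d • x))
    (h : ∀ π : R, Prime π → ∃ d : R, ¬ π ∣ d ∧ IsIntegral R (d • x)) : IsIntegral R x := by
  obtain ⟨d, hd, hdx⟩ := h₀
  induction d using UniqueFactorizationMonoid.induction_on_prime with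
  | h₁ => exact absurd rfl hd
  | h₂ u hu =>
    obtain ⟨v, rfl⟩ := hu
    have := hdx.smul (↑v⁻¹ : R)
    rwa [smul_smul, Units.inv_mul, one_smul] at this
  | h₃ a π ha hπ ih =>
    refine ih ha ?_
    obtain ⟨d, hd, hdx'⟩ := h π hπ
    refine .of_smul_prime hπ hd (by rwa [smul_smul]) ?_
    rw [smul_comm]
    exact hdx'.smul a

/-- A form of Hartogs' lemma: elements which are regular at all primes lying over a principal
prime of a factorial base are integral. -/
theorem Algebra.IsIntegral.of_regular_over_principal {R A B : Type*} [CommRing R] [IsDomain R]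
    [UniqueFactorizationMonoid R] [CommRing A] [CommRing B] [IsDomain B] [Algebra R A]
    [Algebra A B] [Algebra R B] [IsScalarTower R A B] [Algebra.IsIntegral R A]
    [Module.IsTorsionFree R B]
    (h : ∀ Q : Ideal A, Q.IsPrime → ∀ π : R, (π = 0 ∨ Prime π) →
      Q.comap (algebraMap R A) = Ideal.span {π} →
      ∀ b : B, ∃ a ∉ Q, algebraMap A B a * b ∈ (algebraMap A B).range) :
    Algebra.IsIntegral R B := by
  refine ⟨fun b ↦ ?_⟩
  have key (π : R) (hπ : π = 0 ∨ Prime π) : ∃ d, ¬ π ∣ d ∧ IsIntegral R (d • b) := by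
    have hprime : (Ideal.span {π}).IsPrime := by
      rcases hπ with rfl | hπ
      · simpa using Ideal.isPrime_bot
      · rwa [Ideal.span_singleton_prime hπ.ne_zero]
    let D : Ideal A :=
      (LinearMap.range (Algebra.linearMap A B)).comap (LinearMap.toSpanSingleton A B b)
    by_contra! hcon
    obtain ⟨Q, hDQ, hQ, hQc⟩ := Ideal.exists_ideal_over_prime_of_isIntegral (S := A)
      (Ideal.span {π}) D (fun d hd ↦ by
        rw [Ideal.mem_span_singleton]
        by_contra hdvd
        obtain ⟨a, ha⟩ : ∃ a, algebraMap A B a = algebraMap R A d • b := hd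
        refine hcon d hdvd ?_
        rw [← algebraMap_smul A d b, ← ha]
        exact (Algebra.IsIntegral.isIntegral (R := R) a).algebraMap)
    obtain ⟨a, haQ, a', ha'⟩ := h Q hQ π hπ hQc b
    exact haQ (hDQ ⟨a', by simpa [Algebra.smul_def] using ha'⟩)
  refine .of_forall_prime ?_ fun π hπ ↦ key π (.inr hπ)
  obtain ⟨d, hd, hdb⟩ := key 0 (.inl rfl)
  exact ⟨d, by simpa using hd, hdb⟩

/-- Some variable can be dropped while staying independent modulo a given prime. -/
theorem MvPolynomial.exists_algHom_not_dvd {k : Type*} [Field k] {s : ℕ}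
    {π : MvPolynomial (Fin s) k} (hπ : Prime π) :
    ∃ φ : MvPolynomial (Fin (s - 1)) k →ₐ[k] MvPolynomial (Fin s) k, ∀ p ≠ 0, ¬ π ∣ φ p := by
  obtain ⟨i, hi⟩ : ∃ i, π.degreeOf i ≠ 0 := by
    by_contra! h
    have hv : π.vars = ∅ := Finset.eq_empty_of_forall_notMem fun i hi ↦
      mem_vars_iff_degreeOf_ne_zero.mp hi (h i)
    rw [vars_eq_empty_iff_eq_C] at hv
    have hr : π.coeff 0 ≠ 0 := fun h0 ↦ hπ.ne_zero (by rw [hv, h0, C_0])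
    exact hπ.not_isUnit (hv ▸ hr.isUnit.map C)
  obtain ⟨t, rfl⟩ : ∃ t, s = t + 1 := ⟨s - 1, by have := i.2; omega⟩
  refine ⟨rename i.succAbove, fun p hp ⟨q, hq⟩ ↦ hi ?_⟩
  have hinj : Function.Injective (Fin.succAbove i) := Fin.succAbove_right_injective
  have hne : rename i.succAbove p ≠ 0 :=
    (map_ne_zero_iff _ (rename_injective _ hinj)).mpr hp
  have h0 : (rename i.succAbove p).degreeOf i = 0 := by
    by_contra hmi
    obtain ⟨j, -, hj⟩ := mem_vars_rename _ _ (mem_vars_iff_degreeOf_ne_zero.mpr hmi)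
    exact i.succAbove_ne j hj
  have hq0 : q ≠ 0 := by rintro rfl; exact hne (by simpa using hq)
  rw [hq, degreeOf_mul_eq hπ.ne_zero hq0] at h0
  omega

/-- A form of `MvPolynomial.exists_algHom_not_dvd` including the zero ideal. -/
theorem MvPolynomial.exists_algHom_notMem_span {k : Type*} [Field k] {s : ℕ}
    {π : MvPolynomial (Fin s) k} (hπ : π = 0 ∨ Prime π) :
    ∃ φ : MvPolynomial (Fin (s - 1)) k →ₐ[k] MvPolynomial (Fin s) k,
      ∀ p ≠ 0, φ p ∉ Ideal.span {π} := by
  simp only [Ideal.mem_span_singleton]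
  rcases hπ with rfl | hπ
  · refine ⟨rename (Fin.castLE (Nat.sub_le s 1)), fun p hp h ↦ ?_⟩
    exact hp ((map_eq_zero_iff _ (rename_injective _ (Fin.castLE_injective _))).mp
      (zero_dvd_iff.mp h))
  · exact exists_algHom_not_dvd hπ

theorem MvPolynomial.card_le_of_isIntegral_quotients {k K : Type*} [Field k] [Field K] {d s : ℕ}
    (φ : MvPolynomial (Fin d) k →+* K) (g : MvPolynomial (Fin s) k →+* K)
    (h : φ.comp C = g.comp C) (hφ : Function.Injective φ)
    (hg : ∀ z : K, ∃ a b : K, g.IsIntegralElem a ∧ g.IsIntegralElem b ∧ z = a / b) :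
    d ≤ s := by
  let : Algebra k K := (g.comp C).toAlgebra
  let Φ : MvPolynomial (Fin d) k →ₐ[k] K := { φ with commutes' := fun r ↦ RingHom.congr_fun h r }
  let G : MvPolynomial (Fin s) k →ₐ[k] K := { g with commutes' := fun r ↦ rfl }
  have hx : AlgebraicIndependent k (fun i ↦ Φ (X i)) := by
    have : Φ = aeval (fun i ↦ Φ (X i)) := MvPolynomial.aeval_unique Φ
    rw [AlgebraicIndependent, ← this]
    exact hφ
  let s' : Set K := Set.range fun i ↦ G (X i)
  have hG : ∀ p, G p ∈ Algebra.adjoin k s' := fun p ↦ by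
    rw [Algebra.adjoin_range_eq_range_aeval]
    exact ⟨p, DFunLike.congr_fun (MvPolynomial.aeval_unique G).symm p⟩
  have hint (a) (ha : g.IsIntegralElem a) : IsAlgebraic (Algebra.adjoin k s') a := by
    obtain ⟨p, hp, hpa⟩ := ha
    refine IsIntegral.isAlgebraic ⟨p.map (G.codRestrict _ hG).toRingHom, hp.map _, ?_⟩
    rw [Polynomial.eval₂_map]
    exact hpa
  have : Algebra.IsAlgebraic (Algebra.adjoin k s') K := ⟨fun z ↦ by
    obtain ⟨a, b, ha, hb, rfl⟩ := hg z
    rw [div_eq_mul_inv]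
    exact (hint a ha).mul (hint b hb).inv⟩
  have h1 := hx.lift_cardinalMk_le_trdeg
  have h2 := Algebra.IsAlgebraic.trdeg_le_cardinalMk k s'
  have h3 : Cardinal.mk s' ≤ s := by
    have := Cardinal.mk_range_le_lift (f := fun i : Fin s ↦ G (X i))
    simpa using this
  simpa using h1.trans (Cardinal.lift_le.mpr (h2.trans h3))

theorem ringKrullDim_le_of_isIntegral {R S : Type*} [CommRing R] [CommRing S] [Algebra R S]
    [Algebra.IsIntegral R S] : ringKrullDim S ≤ ringKrullDim R := by
  refine Order.krullDim_le_of_strictMono (PrimeSpectrum.comap (algebraMap R S)) fun p q hpq ↦ ?_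
  exact Ideal.IsIntegral.comap_lt_comap (I := p.asIdeal) (J := q.asIdeal) hpq

end Algebra

section Geometry

open CategoryTheory Limits

variable {k : Type u} [Field k] {Y Y' : Scheme.{u}}

/-- The structure map of the sections over `W` of a scheme over `k`. -/
noncomputable def structureRingHom (f : Y ⟶ Spec (.of k)) (W : Y.Opens) : k →+* Γ(Y, W) :=
  (f.appLE ⊤ W (f.preimage_top.symm ▸ le_top)).hom.comp (Scheme.ΓSpecIso (.of k)).inv.hom

theorem map_comp_structureRingHom (f : Y ⟶ Spec (.of k)) {W W' : Y.Opens} (h : W' ≤ W) :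
    (Y.presheaf.map (homOfLE h).op).hom.comp (structureRingHom f W) = structureRingHom f W' := by
  rw [structureRingHom, ← RingHom.comp_assoc, ← CommRingCat.hom_comp, Scheme.Hom.appLE_map]
  rfl

theorem app_comp_structureRingHom (f : Y ⟶ Spec (.of k)) (ι : Y' ⟶ Y) (W : Y.Opens) :
    (ι.app W).hom.comp (structureRingHom f W) = structureRingHom (ι ≫ f) (ι ⁻¹ᵁ W) := by
  rw [structureRingHom, ← RingHom.comp_assoc, ← CommRingCat.hom_comp, Scheme.Hom.app_eq_appLE,
    Scheme.Hom.appLE_comp_appLE]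
  rfl

/-- There are `d` functions near `y` whose values at `y` are algebraically independent over `k`,
i.e. the residue field at `y` has transcendence degree at least `d`. -/
def ResidueIndependent (f : Y ⟶ Spec (.of k)) (y : Y) (d : ℕ) : Prop :=
  ∃ (W : Y.Opens) (φ : MvPolynomial (Fin d) k →+* Γ(Y, W)),
    φ.comp MvPolynomial.C = structureRingHom f W ∧ ∀ p ≠ 0, y ∈ Y.basicOpen (φ p)

theorem ResidueIndependent.comp {f : Y ⟶ Spec (.of k)} (ι : Y' ⟶ Y) {y : Y'} {d : ℕ}
    (h : ResidueIndependent f (ι y) d) : ResidueIndependent (ι ≫ f) y d := by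
  obtain ⟨W, φ, hφ, h⟩ := h
  refine ⟨ι ⁻¹ᵁ W, (ι.app W).hom.comp φ, ?_, fun p hp ↦ ?_⟩
  · rw [RingHom.comp_assoc, hφ, app_comp_structureRingHom]
  · have := h p hp
    change y ∈ ι ⁻¹ᵁ Y.basicOpen (φ p) at this
    rwa [Scheme.preimage_basicOpen] at this

theorem ResidueIndependent.le_of_isIntegral [IsIntegral Y] {f : Y ⟶ Spec (.of k)} {d s : ℕ}
    (h : ResidueIndependent f (genericPoint Y) d) {U : Y.Opens} (hU : IsAffineOpen U)
    [Nonempty U] (g : MvPolynomial (Fin s) k →+* Γ(Y, U))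
    (hg : g.comp MvPolynomial.C = structureRingHom f U) (hgi : g.IsIntegral) : d ≤ s := by
  obtain ⟨W, φ, hφ, h⟩ := h
  have hηW : genericPoint Y ∈ W := Y.basicOpen_le _ (h 1 one_ne_zero)
  have : Nonempty W := ⟨_, hηW⟩
  have := functionField_isFractionRing_of_isAffineOpen Y U hU
  let K := Y.functionField
  have hs : (Y.germToFunctionField W).hom.comp (structureRingHom f W) =
      (Y.germToFunctionField U).hom.comp (structureRingHom f U) := by
    rw [← map_comp_structureRingHom f (le_top : W ≤ ⊤),
      ← map_comp_structureRingHom f (le_top : U ≤ ⊤),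
      ← RingHom.comp_assoc, ← RingHom.comp_assoc, ← CommRingCat.hom_comp, ← CommRingCat.hom_comp]
    simp [Scheme.germToFunctionField]
  let ψ := (Y.germToFunctionField W).hom.comp φ
  let γ := (Y.germToFunctionField U).hom.comp g
  refine MvPolynomial.card_le_of_isIntegral_quotients (K := K) ψ γ ?_ ?_ ?_
  · rw [RingHom.comp_assoc, hφ, RingHom.comp_assoc, hg, hs]
  · rw [injective_iff_map_eq_zero]
    intro p hp0
    by_contra hp
    have := (Y.mem_basicOpen _ _ hηW).mp (h p hp)
    exact this.ne_zero hp0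
  · have hint (a) : γ.IsIntegralElem (algebraMap Γ(Y, U) K a) := by
      obtain ⟨q, hq, hqa⟩ := hgi a
      refine ⟨q, hq, ?_⟩
      change Polynomial.eval₂ γ ((Y.germToFunctionField U).hom a) q = 0
      rw [← Polynomial.hom_eval₂, hqa, map_zero]
    intro z
    obtain ⟨a, b, hb, rfl⟩ := IsFractionRing.div_surjective Γ(Y, U) z
    exact ⟨_, _, hint a, hint b, rfl⟩

theorem exists_isIntegral_comp_C_eq_structureRingHom [IsIntegral Y] (f : Y ⟶ Spec (.of k))
    [LocallyOfFiniteType f] {W : Y.Opens} (hW : IsAffineOpen W) [Nonempty W] :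
    ∃ (s : ℕ) (g : MvPolynomial (Fin s) k →+* Γ(Y, W)),
      g.comp MvPolynomial.C = structureRingHom f W ∧ Function.Injective g ∧ g.IsIntegral := by
  have hft : (structureRingHom f W).FiniteType :=
    .comp (f.finiteType_appLE (isAffineOpen_top _) hW (f.preimage_top.symm ▸ le_top))
      (.of_surjective _ (Scheme.ΓSpecIso (.of k)).commRingCatIsoToRingEquiv.symm.surjective)
  let := (structureRingHom f W).toAlgebra
  have : Algebra.FiniteType k Γ(Y, W) := hft
  obtain ⟨s, g, hg, hgi⟩ := exists_integral_inj_algHom_of_fg k Γ(Y, W)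
  exact ⟨s, g.toRingHom, g.comp_algebraMap, hg, hgi⟩

/-- The complement of an affine open subset of a variety has codimension at most one. -/
theorem exists_residueIndependent_notMem [IsIntegral Y] [Y.IsSeparated] (f : Y ⟶ Spec (.of k))
    [LocallyOfFiniteType f] {d : ℕ} (h : ResidueIndependent f (genericPoint Y) d) {U : Y.Opens}
    (hU : IsAffineOpen U) [Nonempty U] {y : Y} (hy : y ∉ U) :
    ∃ w ∉ U, ∃ s, d ≤ s ∧ ResidueIndependent f w (s - 1) := by
  obtain ⟨_, ⟨W, hW, rfl⟩, hyW, -⟩ :=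
    Y.isBasis_affineOpens.exists_subset_of_mem_open (Set.mem_univ y) isOpen_univ
  have hW : IsAffineOpen W := hW
  have : Nonempty W := ⟨⟨y, hyW⟩⟩
  obtain ⟨s, g, hg, hinj, hint⟩ := exists_isIntegral_comp_C_eq_structureRingHom f hW
  have hds := h.le_of_isIntegral hW g hg hint
  by_contra! H
  have hUW : IsAffineOpen (U ⊓ W) := hU.inf hW
  have hηU : genericPoint Y ∈ U :=
    ((genericPoint_spec Y).mem_open_set_iff U.isOpen).mpr (by simpa using ‹Nonempty U›)
  have hηW : genericPoint Y ∈ W :=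
    ((genericPoint_spec Y).mem_open_set_iff W.isOpen).mpr (by simpa using ‹Nonempty W›)
  have : Nonempty (U ⊓ W).toScheme := ⟨⟨_, hηU, hηW⟩⟩
  let res := (Y.presheaf.map (homOfLE (inf_le_right : U ⊓ W ≤ W)).op).hom
  have hres : Function.Injective res := map_injective_of_isIntegral Y _
  let : Algebra (MvPolynomial (Fin s) k) Γ(Y, W) := g.toAlgebra
  let : Algebra Γ(Y, W) Γ(Y, U ⊓ W) := res.toAlgebra
  let : Algebra (MvPolynomial (Fin s) k) Γ(Y, U ⊓ W) := (res.comp g).toAlgebra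
  have : IsScalarTower (MvPolynomial (Fin s) k) Γ(Y, W) Γ(Y, U ⊓ W) := .of_algebraMap_eq' rfl
  have : Algebra.IsIntegral (MvPolynomial (Fin s) k) Γ(Y, W) := ⟨hint⟩
  have : Module.IsTorsionFree (MvPolynomial (Fin s) k) Γ(Y, U ⊓ W) := by
    rw [Module.isTorsionFree_iff_algebraMap_injective]
    exact hres.comp hinj
  have hB : Algebra.IsIntegral (MvPolynomial (Fin s) k) Γ(Y, U ⊓ W) := by
    refine Algebra.IsIntegral.of_regular_over_principal (A := Γ(Y, W)) fun Q hQ π hπ hQπ b ↦ ?_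
    obtain ⟨φ, hφ⟩ := MvPolynomial.exists_algHom_notMem_span hπ
    let w : Y := hW.fromSpec ⟨Q, hQ⟩
    have hw (a : Γ(Y, W)) : w ∈ Y.basicOpen a ↔ a ∉ Q := by
      change _ ∈ hW.fromSpec ⁻¹ᵁ Y.basicOpen a ↔ _
      rw [hW.fromSpec_preimage_basicOpen]
      rfl
    have hwU : w ∈ U := by
      by_contra hwU
      refine H w hwU s hds ⟨W, g.comp φ.toRingHom, ?_, fun p hp ↦ ?_⟩
      · rw [← hg, RingHom.comp_assoc]
        congr 1
        exact φ.comp_algebraMap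
      · rw [hw]
        have := hφ p hp
        rwa [← hQπ] at this
    have hwW : w ∈ W := by
      have : w ∈ Set.range hW.fromSpec := ⟨_, rfl⟩
      rwa [hW.range_fromSpec] at this
    obtain ⟨a, haU, hwa⟩ := hW.exists_basicOpen_le (V := U ⊓ W) ⟨w, hwU, hwW⟩ hwW
    have := hW.isLocalization_basicOpen a
    obtain ⟨N, a', ha'⟩ := IsLocalization.Away.surj a
      ((Y.presheaf.map (homOfLE haU).op).hom b)
    refine ⟨a ^ N, fun haN ↦ (hw a).mp hwa (hQ.mem_of_pow_mem _ haN), a', ?_⟩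
    have : Nonempty (Y.basicOpen a) := ⟨⟨w, hwa⟩⟩
    apply map_injective_of_isIntegral Y (homOfLE haU)
    have hcomp (x : Γ(Y, W)) : (Y.presheaf.map (homOfLE haU).op).hom
        (algebraMap Γ(Y, W) Γ(Y, U ⊓ W) x) = algebraMap Γ(Y, W) Γ(Y, Y.basicOpen a) x := by
      change (Y.presheaf.map (homOfLE haU).op).hom ((Y.presheaf.map _).hom x) = _
      rw [← CommRingCat.comp_apply, ← Y.presheaf.map_comp]
      rfl
    rw [hcomp, ← ha', map_mul, hcomp, map_pow, mul_comm]
  have hAB : Algebra.IsIntegral Γ(Y, W) Γ(Y, U ⊓ W) := .tower_top (MvPolynomial (Fin s) k)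
  obtain ⟨p, hp⟩ : ∃ p : PrimeSpectrum Γ(Y, W), hW.fromSpec p = y := by
    change y ∈ Set.range hW.fromSpec
    rwa [hW.range_fromSpec]
  obtain ⟨q, -, hq, hqp⟩ := Ideal.exists_ideal_over_prime_of_isIntegral (S := Γ(Y, U ⊓ W))
    p.asIdeal ⊥ (by
      rw [← RingHom.ker_eq_comap_bot]
      change RingHom.ker res ≤ _
      rw [(RingHom.injective_iff_ker_eq_bot _).mp hres]
      exact bot_le)
  refine hy ?_
  have : hUW.fromSpec ⟨q, hq⟩ = y := by
    rw [← hp, ← hW.map_fromSpec hUW (homOfLE inf_le_right).op]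
    change hW.fromSpec (PrimeSpectrum.comap res ⟨q, hq⟩) = _
    congr 1
    exact PrimeSpectrum.ext hqp
  have : y ∈ Set.range hUW.fromSpec := ⟨_, this⟩
  rw [hUW.range_fromSpec] at this
  exact this.1

instance Scheme.Hom.isReduced_image {X Y : Scheme.{u}} (f : X ⟶ Y) [QuasiCompact f] [IsReduced X] :
    IsReduced f.image := by
  have (U : Y.affineOpens) : IsReduced (f.ker.subschemeCover.openCover.X U) := by
    change IsReduced (Spec (.of (Γ(Y, U) ⧸ f.ker.ideal U)))
    rw [affine_isReduced_iff, f.ker_apply]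
    exact isReduced_of_injective _ (RingHom.kerLift_injective (f.app U).hom)
  exact @IsReduced.of_openCover _ f.ker.subschemeCover.openCover this

/-- The closure of a point is the range of a closed immersion from an integral scheme. -/
theorem exists_isIntegral_range_eq_closure_singleton [QuasiSeparatedSpace Y] (w : Y) :
    ∃ (Z : Scheme.{u}) (_ : IsIntegral Z) (ι : Z ⟶ Y), IsClosedImmersion ι ∧
      Set.range ι = closure {w} ∧ ι (genericPoint Z) = w := by
  let j := Y.fromSpecResidueField w
  have : IsReduced (Spec (Y.residueField w)) := inferInstance
  have : IrreducibleSpace j.image := by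
    have h : IsIrreducible (Set.range j.toImage) := by
      rw [← Set.image_univ]
      exact (IrreducibleSpace.isIrreducible_univ _).image _ j.toImage.continuous.continuousOn
    have := h.closure
    rw [j.toImage.denseRange.closure_range] at this
    exact irreducibleSpace_def _ |>.mpr this
  have : IsIntegral j.image := isIntegral_of_irreducibleSpace_of_isReduced _
  have hr : Set.range j.imageι = closure {w} := by
    rw [Scheme.Hom.imageι, Scheme.IdealSheafData.range_subschemeι, Scheme.Hom.support_ker,
      Scheme.range_fromSpecResidueField]
  refine ⟨j.image, this, j.imageι, inferInstance, hr, ?_⟩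
  have := (genericPoint_spec j.image).image j.imageι.continuous
  rw [Set.image_univ, hr, closure_closure] at this
  exact this.eq isGenericPoint_closure

/-- An open subset of a reduced scheme is affine if it is the range of an immersion from an affine
scheme. -/
theorem isAffineOpen_of_range_eq [IsReduced Y] {Z : Scheme.{u}} [IsAffine Z] (g : Z ⟶ Y)
    [IsImmersion g] {U : Y.Opens} (hU : Set.range g = U) : IsAffineOpen U := by
  have hr : Set.range g ⊆ Set.range U.ι := by rw [hU, Scheme.Opens.range_ι]
  let g' := IsOpenImmersion.lift U.ι g hr
  have hg' : g' ≫ U.ι = g := IsOpenImmersion.lift_fac U.ι g hr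
  have : IsPreimmersion (g' ≫ U.ι) := by rw [hg']; infer_instance
  have : IsPreimmersion g' := .of_comp g' U.ι
  have : Surjective g' := ⟨fun x ↦ by
    obtain ⟨z, hz⟩ := hU.ge x.2
    refine ⟨z, U.ι.injective ?_⟩
    rw [← Scheme.Hom.comp_apply, hg', hz]
    rfl⟩
  have : IsClosedImmersion g' := .of_isPreimmersion _ (by
    rw [this.surj.range_eq]; exact isClosed_univ)
  have := isIso_of_isClosedImmersion_of_surjective g'
  exact .of_isIso (inv g')

theorem ResidueIndependent.eq_zero_of_isAffine [IsIntegral Y] [IsAffine Y] {f : Y ⟶ Spec (.of k)}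
    [UniversallyClosed f] {d : ℕ} (h : ResidueIndependent f (genericPoint Y) d) : d = 0 := by
  let e := MvPolynomial.isEmptyAlgEquiv k (Fin 0)
  have hc : (structureRingHom f ⊤).IsIntegral := by
    refine .trans _ _ (RingHom.isIntegral_of_surjective _
      (Scheme.ΓSpecIso (.of k)).commRingCatIsoToRingEquiv.symm.surjective) ?_
    have := isIntegral_appTop_of_universallyClosed f
    rwa [Scheme.Hom.appTop, Scheme.Hom.app_eq_appLE] at this
  have : Nonempty (⊤ : Y.Opens) := ⟨⟨genericPoint Y, trivial⟩⟩
  refine Nat.le_zero.mp (h.le_of_isIntegral (isAffineOpen_top Y)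
    ((structureRingHom f ⊤).comp e.toRingEquiv.toRingHom) ?_
    (.trans _ _ (RingHom.isIntegral_of_surjective _ e.surjective) hc))
  ext x
  exact congrArg (structureRingHom f ⊤) (e.commutes x)

/-- A complete variety with a filtration by `n` closed subsets whose successive differences are
affine has dimension less than `n`. -/
theorem ResidueIndependent.add_one_le_card_cells (n : ℕ) {Y : Scheme.{u}} [IsIntegral Y]
    (f : Y ⟶ Spec (.of k)) [AlgebraicGeometry.IsSeparated f] [LocallyOfFiniteType f]
    [UniversallyClosed f] (F : ℕ → Set Y) (h_zero : F 0 = ∅) (h_univ : F n = Set.univ)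
    (hF : ∀ i, IsClosed (F i))
    (hcell : ∀ i < n, ∃ (Z : Scheme.{u}) (g : Z ⟶ Y), IsAffine Z ∧ IsImmersion g ∧
      Set.range g = F (i + 1) \ F i)
    {d : ℕ} (h : ResidueIndependent f (genericPoint Y) d) : d + 1 ≤ n := by
  induction n generalizing Y d with
  | zero =>
    have : genericPoint Y ∈ F 0 := h_univ ▸ Set.mem_univ _
    simp [h_zero] at this
  | succ n ih =>
    have : Y.IsSeparated := ⟨by
      rw [show terminal.from Y = f ≫ terminal.from _ from Subsingleton.elim _ _]
      infer_instance⟩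
    let U : Y.Opens := ⟨(F n)ᶜ, (hF n).isOpen_compl⟩
    have hU : IsAffineOpen U := by
      obtain ⟨Z, g, hZ, hg, hr⟩ := hcell n n.lt_succ_self
      refine isAffineOpen_of_range_eq g (U := U) ?_
      rw [hr, h_univ, ← Set.compl_eq_univ_sdiff]
      rfl
    by_cases hUe : F n = Set.univ
    · have := ih f F h_zero hUe hF (fun i hi ↦ hcell i (hi.trans n.lt_succ_self)) h
      omega
    have : Nonempty U := by
      obtain ⟨y, hy⟩ := (Set.ne_univ_iff_exists_notMem _).mp hUe
      exact ⟨⟨y, hy⟩⟩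
    rcases (F n).eq_empty_or_nonempty with hne | ⟨y, hy⟩
    · have hUtop : U = ⊤ := by ext; simp [U, hne]
      have : IsAffine (⊤ : Y.Opens) := hUtop ▸ hU
      have : IsAffine Y := .of_isIso Y.topIso.inv
      have := h.eq_zero_of_isAffine
      omega
    · obtain ⟨w, hw, s, hds, hws⟩ :=
        exists_residueIndependent_notMem f h hU (y := y) (by simpa [U] using hy)
      obtain ⟨Y', hY', ι, hι, hr, rfl⟩ := exists_isIntegral_range_eq_closure_singleton w
      have hwF : Set.range ι ⊆ F n :=
        hr ▸ closure_minimal (by simpa [U] using hw) (hF n)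
      have := ih (ι ≫ f) (fun i ↦ ι ⁻¹' F i) (by simp [h_zero])
        (Set.eq_univ_of_forall fun x ↦ hwF ⟨x, rfl⟩) (fun i ↦ (hF i).preimage ι.continuous)
        (fun i hi ↦ ?_) (hws.comp ι)
      · omega
      obtain ⟨Z, g, hZ, hg, hr⟩ := hcell i (hi.trans n.lt_succ_self)
      refine ⟨pullback ι g, pullback.fst ι g, ?_, inferInstance, ?_⟩
      · exact isAffine_of_isAffineHom (pullback.snd ι g)
      · rw [Scheme.Pullback.range_fst, hr]
        rfl

theorem Topology.IsOpenEmbedding.coheight_le_topologicalKrullDim {X Y : Type*} [TopologicalSpace X]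
    [TopologicalSpace Y] {f : X → Y} (hf : Topology.IsOpenEmbedding f)
    (Z : TopologicalSpace.IrreducibleCloseds Y) (hZ : (f ⁻¹' Z).Nonempty) :
    (Order.coheight Z : WithBot ℕ∞) ≤ topologicalKrullDim X := by
  let e := TopologicalSpace.IrreducibleCloseds.orderIsoOfIsOpenEmbedding f hf
  have he : TopologicalSpace.IrreducibleCloseds.map f hf.continuous (e.symm ⟨Z, hZ⟩) = Z :=
    congrArg Subtype.val (e.apply_symm_apply ⟨Z, hZ⟩)
  rw [← he, hf.coheight_map]
  exact Order.coheight_le_krullDim _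

theorem topologicalKrullDim_le_of_residueIndependent [IsIntegral Y] (f : Y ⟶ Spec (.of k))
    [LocallyOfFiniteType f] {m : ℕ}
    (h : ∀ s, ResidueIndependent f (genericPoint Y) s → s ≤ m) : topologicalKrullDim Y ≤ m := by
  rw [topologicalKrullDim, Order.krullDim_eq_iSup_coheight]
  refine iSup_le fun Z ↦ ?_
  obtain ⟨y, hy⟩ := Z.2.nonempty
  obtain ⟨_, ⟨W, hW, rfl⟩, hyW, -⟩ :=
    Y.isBasis_affineOpens.exists_subset_of_mem_open (Set.mem_univ y) isOpen_univ
  have hW : IsAffineOpen W := hW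
  have : Nonempty W := ⟨⟨y, hyW⟩⟩
  obtain ⟨s, g, hg, hinj, hint⟩ := exists_isIntegral_comp_C_eq_structureRingHom f hW
  have hs : s ≤ m := h s ⟨W, g, hg, fun p hp ↦ by
    refine ((genericPoint_spec Y).mem_open_set_iff (Y.basicOpen _).isOpen).mpr ?_
    have : Y.basicOpen (g p) ≠ ⊥ := by
      rw [Ne, basicOpen_eq_bot_iff, map_eq_zero_iff _ hinj]
      exact hp
    simpa [← TopologicalSpace.Opens.ne_bot_iff_nonempty] using this⟩
  have hyr : (hW.fromSpec ⁻¹' Z).Nonempty := by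
    have : y ∈ Set.range hW.fromSpec := by rwa [hW.range_fromSpec]
    obtain ⟨x, rfl⟩ := this
    exact ⟨x, hy⟩
  let := g.toAlgebra
  have : Algebra.IsIntegral (MvPolynomial (Fin s) k) Γ(Y, W) := ⟨hint⟩
  calc (Order.coheight Z : WithBot ℕ∞)
    _ ≤ topologicalKrullDim (Spec Γ(Y, W)) :=
      hW.fromSpec.isOpenEmbedding.coheight_le_topologicalKrullDim Z hyr
    _ = ringKrullDim Γ(Y, W) := PrimeSpectrum.topologicalKrullDim_eq_ringKrullDim _
    _ ≤ ringKrullDim (MvPolynomial (Fin s) k) := ringKrullDim_le_of_isIntegral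
    _ = s := by simp [MvPolynomial.ringKrullDim_of_isNoetherianRing, ringKrullDim_eq_zero_of_field]
    _ ≤ m := by exact_mod_cast hs

end Geometry

/-- **Corollary (cell count).**
Let `k` be an algebraically closed field and `X` a complete variety over `k` (an integral
separated scheme of finite type over `k` whose structure morphism is universally closed).
Suppose `X = S 1 ⊔ … ⊔ S n` is a partition of the underlying space into pairwise disjoint
locally closed subsets with each partial union `S 1 ∪ … ∪ S j` closed, and each `S i` an
affine cell (the homeomorphic image, under an immersion `Z ⟶ X`, of an integral affine
scheme `Z` of finite type over `k`).  Then `n ≥ dim X + 1`. -/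
theorem cell_count {k : Type u} [Field k] [IsAlgClosed k]
    (X : Scheme.{u}) (f : X ⟶ Spec (CommRingCat.of k))
    [IsIntegral X] [AlgebraicGeometry.IsSeparated f]
    [LocallyOfFiniteType f] [QuasiCompact f] [UniversallyClosed f]
    {n : ℕ} (S : Fin n → Set X)
    (hdisj : Pairwise (Function.onFun Disjoint S))
    (hlc : ∀ i, IsLocallyClosed (S i))
    (hcov : ⋃ i, S i = Set.univ)
    (hfilt : ∀ j : Fin n, IsClosed (⋃ i ≤ j, S i))
    (hcell : ∀ i, ∃ (Z : Scheme.{u}) (g : Z ⟶ X) (h : Z ⟶ Spec (CommRingCat.of k)),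
      IsAffine Z ∧ IsIntegral Z ∧ LocallyOfFiniteType h ∧ QuasiCompact h ∧
        IsImmersion g ∧ Set.range g.base = S i) :
    topologicalKrullDim X + 1 ≤ (n : WithBot ℕ∞) := by
  let F (j : ℕ) : Set X := ⋃ i : Fin n, ⋃ _ : (i : ℕ) < j, S i
  have hF_univ : F n = Set.univ := by simp [F, hcov]
  have hF_closed (j : ℕ) : IsClosed (F j) := by
    rcases j with _ | j
    · simp [F]
    · by_cases hj : j < n
      · convert hfilt ⟨j, hj⟩ using 5
        simp [Fin.le_def]
      · convert isClosed_univ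
        refine Set.eq_univ_of_univ_subset (hF_univ.ge.trans ?_)
        exact Set.iUnion_mono fun i ↦ Set.iUnion_mono' fun h ↦ ⟨by omega, le_rfl⟩
  have hF_cell (j : ℕ) (hj : j < n) : ∃ (Z : Scheme.{u}) (g : Z ⟶ X), IsAffine Z ∧
      IsImmersion g ∧ Set.range g = F (j + 1) \ F j := by
    obtain ⟨Z, g, -, hZ, -, -, -, hg, hr⟩ := hcell ⟨j, hj⟩
    refine ⟨Z, g, hZ, hg, hr.trans ?_⟩
    ext x
    simp only [F, Set.mem_sdiff, Set.mem_iUnion, not_exists, exists_prop, not_and]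
    constructor
    · refine fun hx ↦ ⟨⟨⟨j, hj⟩, j.lt_succ_self, hx⟩, fun i hi hxi ↦ ?_⟩
      exact Set.disjoint_left.mp (hdisj (i := i) (j := ⟨j, hj⟩) (by rintro rfl; simp at hi)) hxi hx
    · rintro ⟨⟨i, hi, hx⟩, h⟩
      obtain rfl : i = ⟨j, hj⟩ := Fin.ext (by have := mt (h i) (not_not.mpr hx); simp only; omega)
      exact hx
  have key (s : ℕ) (hs : ResidueIndependent f (genericPoint X) s) : s + 1 ≤ n :=
    hs.add_one_le_card_cells n f F (by simp [F]) hF_univ hF_closed hF_cell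
  have hn : 0 < n := by
    by_contra! h
    obtain rfl : n = 0 := by omega
    have : genericPoint X ∈ ⋃ i, S i := hcov ▸ Set.mem_univ _
    simp at this
  have := topologicalKrullDim_le_of_residueIndependent f (m := n - 1) fun s hs ↦ by
    have := key s hs
    omega
  calc topologicalKrullDim X + 1 ≤ ((n - 1 : ℕ) : WithBot ℕ∞) + 1 := by gcongr
    _ = n := by norm_cast; rw [Nat.sub_add_cancel hn]
end

section
/- Let k be an algebraically closed field and let P² denote the projective plane over k, realized as Proj of the polynomial ring k[x, y, z] with its standard grading. Consider the closed subsets Y = V(x) and Z = V(x² − yz), and the three subsets U₁ = P² ∖ (Y ∪ Z), U₂ = Y ∖ V(y), U₃ = Z ∖ V(z) of the underlying topological space of P². Then U₁, U₂, U₃ are pairwise disjoint locally closed subsets covering P², each is irreducible and is an affine cell (each is the homeomorphic image of an immersion into P² from an integral affine scheme of finite type over k), and their Krull dimensions as subspaces are 2, 1, 1 respectively. In particular, this is a locally closed decomposition of the complete variety P² into affine cells having no cell of dimension 0, giving a counterexample to Proposition 4.7 of Białynicki-Birula's 'Some theorems on actions of algebraic groups'. -/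
open AlgebraicGeometry MvPolynomial

attribute [local instance] MvPolynomial.gradedAlgebra

/-- `S` is an *affine cell* of the scheme `W` (over the field `k`): `S` is the homeomorphic
image, under an immersion `Z ⟶ W` of schemes, of an integral affine scheme `Z` of finite
type over `k`. -/
def IsAffineCell (k : Type u) [Field k] (W : Scheme.{u}) (S : Set W) : Prop :=
  ∃ (Z : Scheme.{u}) (g : Z ⟶ W) (h : Z ⟶ Spec (CommRingCat.of k)),
    IsAffine Z ∧ IsIntegral Z ∧ LocallyOfFiniteType h ∧ QuasiCompact h ∧
      IsImmersion g ∧ Set.range g.base = S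

/-- The projective plane over `k`, realized as `Proj` of the polynomial ring `k[x, y, z]`
with its standard grading (here `x = X 0`, `y = X 1`, `z = X 2` in `MvPolynomial (Fin 3) k`). -/
noncomputable def ProjPlane (k : Type) [Field k] : Scheme :=
  Proj (homogeneousSubmodule (Fin 3) k)

/-- `U₁ = ℙ² ∖ (V(x) ∪ V(x² − yz))`. -/
def cellU1 (k : Type) [Field k] : Set (ProjPlane k) :=
  Set.univ \
    (ProjectiveSpectrum.zeroLocus (homogeneousSubmodule (Fin 3) k) {X 0} ∪
      ProjectiveSpectrum.zeroLocus (homogeneousSubmodule (Fin 3) k) {X 0 ^ 2 - X 1 * X 2})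

/-- `U₂ = V(x) ∖ V(y)`. -/
def cellU2 (k : Type) [Field k] : Set (ProjPlane k) :=
  ProjectiveSpectrum.zeroLocus (homogeneousSubmodule (Fin 3) k) {X 0} \
    ProjectiveSpectrum.zeroLocus (homogeneousSubmodule (Fin 3) k) {X 1}

/-- `U₃ = V(x² − yz) ∖ V(z)`. -/
def cellU3 (k : Type) [Field k] : Set (ProjPlane k) :=
  ProjectiveSpectrum.zeroLocus (homogeneousSubmodule (Fin 3) k) {X 0 ^ 2 - X 1 * X 2} \
    ProjectiveSpectrum.zeroLocus (homogeneousSubmodule (Fin 3) k) {X 2}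

section DimensionBound

open HomogeneousIdeal

variable (k : Type) [Field k]

lemma le_irrelevant_of_isPrime (P : HomogeneousIdeal (homogeneousSubmodule (Fin 3) k))
    (hP : P.toIdeal.IsPrime) : P ≤ irrelevant (homogeneousSubmodule (Fin 3) k) := by
  intro a ha
  rw [mem_irrelevant_iff]
  have h := P.isHomogeneous 0 ha
  have h0 : (GradedRing.proj (homogeneousSubmodule (Fin 3) k) 0 a) ∈
      homogeneousSubmodule (Fin 3) k 0 := by
    rw [GradedRing.proj_apply]
    exact SetLike.coe_mem _
  rw [← GradedRing.proj_apply] at h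
  generalize GradedRing.proj (homogeneousSubmodule (Fin 3) k) 0 a = b at h h0
  rw [homogeneousSubmodule_zero, Submodule.mem_one] at h0
  obtain ⟨c, rfl⟩ := h0
  by_contra hc
  have hc' : c ≠ 0 := by rintro rfl; simp at hc
  exact hP.ne_top (Ideal.eq_top_of_isUnit_mem _ h ((IsUnit.mk0 c hc').map _))

/-- Primes of `k[x, y, z]` given by the points of the projective plane, with the irrelevant ideal
adjoined as a top element. -/
noncomputable def conePrime :
    WithTop (ProjectiveSpectrum (homogeneousSubmodule (Fin 3) k)) →
      PrimeSpectrum (MvPolynomial (Fin 3) k)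
  | none => ⟨(irrelevant (homogeneousSubmodule (Fin 3) k)).toIdeal, by
      rw [toIdeal_irrelevant]; exact RingHom.ker_isPrime _⟩
  | some P => ⟨P.asHomogeneousIdeal.toIdeal, P.isPrime⟩

lemma conePrime_strictMono : StrictMono (conePrime k) := by
  intro a b hab
  cases a with
  | top => simp at hab
  | coe P =>
    cases b with
    | top =>
      exact lt_of_le_not_ge (le_irrelevant_of_isPrime k _ P.isPrime) P.not_irrelevant_le
    | coe Q => exact show P < Q from WithTop.coe_lt_coe.mp hab

lemma topologicalKrullDim_projPlane_eq_krullDim :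
    topologicalKrullDim (ProjPlane k) =
      Order.krullDim (ProjectiveSpectrum (homogeneousSubmodule (Fin 3) k)) := by
  let : QuasiSober (ProjectiveSpectrum (homogeneousSubmodule (Fin 3) k)) :=
    inferInstanceAs (QuasiSober (Proj (homogeneousSubmodule (Fin 3) k)))
  let : T0Space (ProjectiveSpectrum (homogeneousSubmodule (Fin 3) k)) :=
    inferInstanceAs (T0Space (Proj (homogeneousSubmodule (Fin 3) k)))
  rw [← Order.krullDim_orderDual]
  refine Order.krullDim_eq_of_orderIso (α := TopologicalSpace.IrreducibleCloseds
    (ProjectiveSpectrum (homogeneousSubmodule (Fin 3) k))) ?_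
  refine
    { toEquiv := (@irreducibleSetEquivPoints _ _ _ _).toEquiv.trans OrderDual.toDual
      map_rel_iff' := ?_ }
  intro s t
  rw [← (@irreducibleSetEquivPoints _ _ _ _).map_rel_iff]
  refine (ProjectiveSpectrum.le_iff_mem_closure _ _ _).trans ?_
  exact specializes_iff_mem_closure.symm

lemma topologicalKrullDim_projPlane_le : topologicalKrullDim (ProjPlane k) ≤ 2 := by
  rw [topologicalKrullDim_projPlane_eq_krullDim]
  cases isEmpty_or_nonempty (ProjectiveSpectrum (homogeneousSubmodule (Fin 3) k))
  · simp [Order.krullDim_eq_bot]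
  have h := Order.krullDim_le_of_strictMono _ (conePrime_strictMono k)
  rw [Order.krullDim_WithTop] at h
  change _ ≤ ringKrullDim _ at h
  rw [MvPolynomial.ringKrullDim_of_isNoetherianRing, ringKrullDim_eq_zero_of_field] at h
  have h' : Order.krullDim (ProjectiveSpectrum (homogeneousSubmodule (Fin 3) k)) + 1 ≤ 2 + 1 := by
    refine h.trans_eq ?_
    simp
    norm_num
  exact ENat.WithBot.add_le_add_one_right_iff.mp h'

end DimensionBound

section ClosedInChart

open CategoryTheory HomogeneousLocalization

variable {k : Type} [Field k]

/-- The structure map from `k` to a homogeneous localization of `k[x, y, z]`. -/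
noncomputable def constHom (f : MvPolynomial (Fin 3) k) :
    k →+* Away (homogeneousSubmodule (Fin 3) k) f :=
  (algebraMap (homogeneousSubmodule (Fin 3) k 0) _).comp
    (algebraMap k (homogeneousSubmodule (Fin 3) k 0))

@[simp]
lemma val_constHom (f : MvPolynomial (Fin 3) k) (c : k) :
    (constHom f c).val = algebraMap (MvPolynomial (Fin 3) k) (Localization.Away f) (C c) := rfl

lemma X_mem (i : Fin 3) : (X i : MvPolynomial (Fin 3) k) ∈ homogeneousSubmodule (Fin 3) k 1 :=
  isHomogeneous_X k i

/-- The coordinate `Xᵢ / Xⱼ` on the chart `D₊(Xⱼ)`. -/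
noncomputable def coord (j i : Fin 3) :
    Away (homogeneousSubmodule (Fin 3) k) (X j : MvPolynomial (Fin 3) k) :=
  Away.mk (homogeneousSubmodule (Fin 3) k) (X_mem j) 1 (X i) (X_mem i)

lemma coord_self (j : Fin 3) : coord (k := k) j j = 1 := by
  apply val_injective
  rw [coord, Away.val_mk, val_one, Localization.mk_eq_mk', IsLocalization.mk'_eq_iff_eq_mul]
  simp

/-- The substitution `Xᵢ ↦ Xᵢ / Xⱼ`. -/
noncomputable def dehomogenize (j : Fin 3) : MvPolynomial (Fin 3) k →+*
    Away (homogeneousSubmodule (Fin 3) k) (X j : MvPolynomial (Fin 3) k) :=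
  eval₂Hom (constHom _) (coord j)

lemma algebraMap_X_mul_val_coord (j i : Fin 3) :
    algebraMap (MvPolynomial (Fin 3) k) (Localization.Away (X j : MvPolynomial (Fin 3) k)) (X j) *
      (coord j i).val = algebraMap (MvPolynomial (Fin 3) k) _ (X i) := by
  rw [coord, Away.val_mk, Localization.mk_eq_mk', IsLocalization.mul_mk'_eq_mk'_of_mul,
    IsLocalization.mk'_eq_iff_eq_mul]
  simp [mul_comm]

lemma pow_mul_val_dehomogenize (j : Fin 3) (d : ℕ) (n : MvPolynomial (Fin 3) k)
    (hn : n.IsHomogeneous d) :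
    algebraMap (MvPolynomial (Fin 3) k) (Localization.Away (X j : MvPolynomial (Fin 3) k))
      (X j) ^ d * (dehomogenize j n).val = algebraMap _ _ n := by
  simp only [← HomogeneousLocalization.algebraMap_apply, dehomogenize, coe_eval₂Hom, eval₂_eq,
    map_sum, Finset.mul_sum]
  conv_rhs => rw [n.as_sum, map_sum]
  refine Finset.sum_congr rfl fun s hs ↦ ?_
  have hd : ∑ i ∈ s.support, s i = d := by
    have h := hn (mem_support_iff.mp hs)
    have h' : s.degree = d := by
      rw [Finsupp.degree_eq_weight_one]
      exact h
    rwa [Finsupp.degree_apply] at h'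
  rw [monomial_eq, ← hd, ← Finset.prod_pow_eq_pow_sum, map_mul, map_mul, map_prod, Finsupp.prod,
    map_prod, mul_left_comm, ← Finset.prod_mul_distrib]
  congr 1
  refine Finset.prod_congr rfl fun i _ ↦ ?_
  rw [map_pow, map_pow, ← mul_pow, HomogeneousLocalization.algebraMap_apply,
    algebraMap_X_mul_val_coord]

lemma mk_eq_dehomogenize (j : Fin 3) (d : ℕ) (n : MvPolynomial (Fin 3) k)
    (hn : n ∈ homogeneousSubmodule (Fin 3) k (d • 1)) :
    Away.mk _ (X_mem j) d n hn = dehomogenize j n := by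
  apply val_injective
  rw [Away.val_mk, Localization.mk_eq_mk', IsLocalization.mk'_eq_iff_eq_mul, mul_comm]
  rw [← pow_mul_val_dehomogenize j d n (by simpa using hn)]
  simp

lemma dehomogenize_surjective (j : Fin 3) : Function.Surjective (dehomogenize (k := k) j) := by
  intro a
  obtain ⟨d, n, hn, rfl⟩ := Away.mk_surjective _ (X_mem j) a
  exact ⟨n, (mk_eq_dehomogenize j d n hn).symm⟩

variable {R : Type} [CommRing R] [Algebra k R] (j : Fin 3) (v : Fin 3 → R) (hv : v j = 1)

/-- Evaluation of functions on the chart `D₊(Xⱼ)` at a point whose `j`-th coordinate is `1`. -/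
noncomputable def evalAway :
    Away (homogeneousSubmodule (Fin 3) k) (X j : MvPolynomial (Fin 3) k) →+* R :=
  (IsLocalization.Away.lift (S := Localization.Away (X j : MvPolynomial (Fin 3) k)) (X j)
    (g := (aeval (R := k) v).toRingHom) (by simp [hv])).comp
    (algebraMap _ (Localization.Away (X j : MvPolynomial (Fin 3) k)))

lemma evalAway_dehomogenize (n : MvPolynomial (Fin 3) k) :
    evalAway (k := k) j v hv (dehomogenize j n) = aeval (R := k) v n := by
  suffices h : (evalAway j v hv).comp (dehomogenize j) = (aeval (R := k) v).toRingHom from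
    DFunLike.congr_fun h n
  apply MvPolynomial.ringHom_ext
  · intro c
    simp [evalAway, dehomogenize]
  · intro i
    have h := congr_arg (IsLocalization.Away.lift
      (S := Localization.Away (X j : MvPolynomial (Fin 3) k)) (X j)
      (g := (aeval (R := k) v).toRingHom) (by simp [hv])) (algebraMap_X_mul_val_coord j i)
    simpa [evalAway, dehomogenize, hv] using h

lemma evalAway_surjective (h : Function.Surjective (aeval (R := k) v)) :
    Function.Surjective (evalAway (k := k) j v hv) := fun r ↦ by
  obtain ⟨n, rfl⟩ := h r
  exact ⟨_, evalAway_dehomogenize j v hv n⟩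

lemma ker_evalAway {e : ℕ} {g : MvPolynomial (Fin 3) k}
    (hg : g ∈ homogeneousSubmodule (Fin 3) k e) (hgv : aeval (R := k) v g = 0)
    (ψ : R →+* Away (homogeneousSubmodule (Fin 3) k) (X j : MvPolynomial (Fin 3) k))
    (hψ : ∀ c, ψ (algebraMap k R c) = constHom _ c)
    (hI : ∀ i, ψ (v i) - coord j i ∈ Ideal.span {Away.isLocalizationElem (X_mem j) hg}) :
    RingHom.ker (evalAway (k := k) j v hv) = Ideal.span {Away.isLocalizationElem (X_mem j) hg} := by
  apply le_antisymm
  · intro a ha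
    obtain ⟨n, rfl⟩ := dehomogenize_surjective j a
    rw [RingHom.mem_ker, evalAway_dehomogenize] at ha
    have h : (Ideal.Quotient.mk (Ideal.span {Away.isLocalizationElem (X_mem j) hg})).comp
        (dehomogenize j) = (Ideal.Quotient.mk _).comp (ψ.comp (aeval (R := k) v).toRingHom) := by
      apply MvPolynomial.ringHom_ext
      · intro c
        simp [dehomogenize, hψ]
      · intro i
        simpa [dehomogenize] using (Ideal.Quotient.eq.mpr (hI i)).symm
    rw [← Ideal.Quotient.eq_zero_iff_mem]
    have := DFunLike.congr_fun h n
    simpa [ha] using this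
  · rw [Ideal.span_le, Set.singleton_subset_iff, SetLike.mem_coe, RingHom.mem_ker,
      Away.isLocalizationElem, mk_eq_dehomogenize, evalAway_dehomogenize]
    simp [hgv]

lemma range_specMap_comp_awayι {S : Type} [CommRing S] {m e : ℕ} {f g : MvPolynomial (Fin 3) k}
    (hf : f ∈ homogeneousSubmodule (Fin 3) k m) (hm : 0 < m)
    (hg : g ∈ homogeneousSubmodule (Fin 3) k e) (he : 0 < e)
    (φ : Away (homogeneousSubmodule (Fin 3) k) f →+* S) (hφ : Function.Surjective φ)
    (hker : RingHom.ker φ = Ideal.span {Away.isLocalizationElem hf hg}) :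
    Set.range (Spec.map (CommRingCat.ofHom φ) ≫ Proj.awayι _ f hf hm) =
      (ProjectiveSpectrum.zeroLocus (homogeneousSubmodule (Fin 3) k) {g} \
        ProjectiveSpectrum.zeroLocus (homogeneousSubmodule (Fin 3) k) {f} :
        Set (ProjectiveSpectrum _)) := by
  have h1 : Set.range (Spec.map (CommRingCat.ofHom φ)) =
      (Proj.awayι _ f hf hm) ⁻¹' (Proj.basicOpen (homogeneousSubmodule (Fin 3) k) g :
        Set (Proj (homogeneousSubmodule (Fin 3) k)))ᶜ := by
    have h2 := congr_arg (fun U ↦ (SetLike.coe U)ᶜ)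
      (Proj.awayι_preimage_basicOpen _ hf hm hg he)
    refine Eq.trans ?_ h2.symm
    refine (range_comap_of_surjective _ φ hφ).trans ?_
    rw [hker, PrimeSpectrum.zeroLocus_span]
    exact (compl_compl _).symm.trans
      (congrArg compl (PrimeSpectrum.basicOpen_eq_zeroLocus_compl _).symm)
  have h3 : Set.range (Proj.awayι _ f hf hm) = (Proj.basicOpen (homogeneousSubmodule (Fin 3) k) f :
        Set (Proj (homogeneousSubmodule (Fin 3) k))) :=
    congr_arg SetLike.coe (Proj.opensRange_awayι _ f hf hm)
  rw [Scheme.Hom.comp_base, TopCat.coe_comp, Set.range_comp, h1, Set.image_preimage_eq_inter_range,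
    h3]
  have h4 (a : MvPolynomial (Fin 3) k) :
      (Proj.basicOpen (homogeneousSubmodule (Fin 3) k) a :
        Set (Proj (homogeneousSubmodule (Fin 3) k))) =
        ((ProjectiveSpectrum.zeroLocus _ {a})ᶜ : Set (ProjectiveSpectrum _)) :=
    ProjectiveSpectrum.basicOpen_eq_zeroLocus_compl _ a
  rw [h4, h4]
  exact congrArg (· ∩ (ProjectiveSpectrum.zeroLocus (homogeneousSubmodule (Fin 3) k) {f})ᶜ)
    (compl_compl (ProjectiveSpectrum.zeroLocus (homogeneousSubmodule (Fin 3) k) {g}))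

end ClosedInChart

section Cells

open CategoryTheory HomogeneousLocalization

variable (k : Type) [Field k]

/-- The defining equation `x² - yz` of the conic. -/
noncomputable abbrev conic : MvPolynomial (Fin 3) k := X 0 ^ 2 - X 1 * X 2

lemma conic_mem : conic k ∈ homogeneousSubmodule (Fin 3) k 2 :=
  (isHomogeneous_X_pow 0 2).sub ((isHomogeneous_X k 1).mul (isHomogeneous_X k 2))

lemma X_mul_conic_mem : X 0 * conic k ∈ homogeneousSubmodule (Fin 3) k 3 :=
  (isHomogeneous_X k 0).mul (conic_mem k)

instance : Algebra.FiniteType (homogeneousSubmodule (Fin 3) k 0) (MvPolynomial (Fin 3) k) :=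
  have : IsScalarTower k (homogeneousSubmodule (Fin 3) k 0) (MvPolynomial (Fin 3) k) :=
    IsScalarTower.of_algebraMap_eq (R := k) (S := homogeneousSubmodule (Fin 3) k 0)
      (A := MvPolynomial (Fin 3) k) fun _ ↦ rfl
  .of_restrictScalars_finiteType k _ _

lemma constHom_finiteType {f : MvPolynomial (Fin 3) k} {d : ℕ}
    (hf : f ∈ homogeneousSubmodule (Fin 3) k d) : (constHom f).FiniteType := by
  refine RingHom.FiniteType.comp ?_ (RingHom.FiniteType.of_surjective _ ?_)
  · exact (RingHom.finiteType_algebraMap).mpr (Away.finiteType f d hf)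
  · rintro ⟨a, ha⟩
    have ha' := ha
    rw [homogeneousSubmodule_zero, Submodule.mem_one] at ha'
    obtain ⟨c, hc⟩ := ha'
    exact ⟨c, Subtype.ext hc⟩

lemma isIrreducible_range_of_isDomain {W : Scheme} {S : Type} [CommRing S] [IsDomain S]
    (g : Spec (.of S) ⟶ W) : IsIrreducible (Set.range g) := by
  rw [← Set.image_univ]
  exact (IrreducibleSpace.isIrreducible_univ _).image _ g.continuous.continuousOn

lemma isAffineCell_range {W : Scheme} {S : Type} [CommRing S] [IsDomain S]
    (g : Spec (.of S) ⟶ W) [IsImmersion g] (h : k →+* S) (hh : h.FiniteType) :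
    IsAffineCell k W (Set.range g) := by
  refine ⟨Spec (.of S), g, Spec.map (CommRingCat.ofHom h), inferInstance, inferInstance, ?_,
    inferInstance, inferInstance, rfl⟩
  rw [HasRingHomProperty.Spec_iff (P := @LocallyOfFiniteType)]
  exact hh

lemma topologicalKrullDim_range {W : Scheme} {S : Type} [CommRing S]
    (g : Spec (.of S) ⟶ W) [IsImmersion g] :
    topologicalKrullDim (Set.range g) = ringKrullDim S := by
  rw [← PrimeSpectrum.topologicalKrullDim_eq_ringKrullDim]
  exact ((g.isEmbedding.toHomeomorph).isHomeomorph.topologicalKrullDim_eq _).symm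

lemma exists_immersion_cellU1 :
    ∃ g : Spec (.of (Away (homogeneousSubmodule (Fin 3) k) (X 0 * conic k))) ⟶ ProjPlane k,
      IsImmersion g ∧ Set.range g = cellU1 k := by
  refine ⟨Proj.awayι _ _ (X_mul_conic_mem k) three_pos,
    inferInstanceAs (IsImmersion (Proj.awayι _ _ _ _)), ?_⟩
  refine (congr_arg SetLike.coe
    (Proj.opensRange_awayι _ _ (X_mul_conic_mem k) three_pos)).trans ?_
  refine (ProjectiveSpectrum.basicOpen_eq_zeroLocus_compl _ (X 0 * conic k)).trans ?_
  rw [ProjectiveSpectrum.zeroLocus_singleton_mul, Set.compl_eq_univ_sdiff]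
  rfl

/-- The curve in the chart `D₊(Xⱼ)` parametrized by `v` is cut out by `g`. -/
lemma exists_immersion_of_parametrization (j : Fin 3) (v : Fin 3 → Polynomial k) (hv : v j = 1)
    (i₀ : Fin 3) (hi₀ : v i₀ = Polynomial.X) {e : ℕ} (he : 0 < e) {g : MvPolynomial (Fin 3) k}
    (hg : g ∈ homogeneousSubmodule (Fin 3) k e) (hgv : aeval (R := k) v g = 0)
    (hI : ∀ i, (v i).eval₂ (constHom _) (coord j i₀) - coord j i ∈
      Ideal.span {Away.isLocalizationElem (X_mem j) hg}) :
    ∃ f : Spec (.of (Polynomial k)) ⟶ ProjPlane k,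
      IsImmersion f ∧ Set.range f =
        (ProjectiveSpectrum.zeroLocus (homogeneousSubmodule (Fin 3) k) {g} \
          ProjectiveSpectrum.zeroLocus (homogeneousSubmodule (Fin 3) k) {X j} :
          Set (ProjectiveSpectrum _)) := by
  have hs : Function.Surjective (evalAway (k := k) j v hv) := by
    apply evalAway_surjective
    intro p
    refine ⟨Polynomial.aeval (X i₀) p, ?_⟩
    rw [← Polynomial.aeval_algHom_apply, aeval_X, hi₀, Polynomial.aeval_X_left_apply]
  have : IsClosedImmersion (Spec.map (CommRingCat.ofHom (evalAway (k := k) j v hv))) :=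
    IsClosedImmersion.spec_of_surjective _ hs
  refine ⟨Spec.map (CommRingCat.ofHom (evalAway (k := k) j v hv)) ≫
    Proj.awayι _ _ (X_mem j) one_pos, inferInstanceAs (IsImmersion (_ ≫ Proj.awayι _ _ _ _)), ?_⟩
  refine range_specMap_comp_awayι (X_mem j) one_pos hg he _ hs ?_
  exact ker_evalAway j v hv hg hgv (Polynomial.eval₂RingHom (constHom _) (coord j i₀))
    (fun c ↦ by simp [Polynomial.algebraMap_eq]) hI

lemma exists_immersion_cellU2 :
    ∃ f : Spec (.of (Polynomial k)) ⟶ ProjPlane k, IsImmersion f ∧ Set.range f = cellU2 k := by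
  refine exists_immersion_of_parametrization k 1 ![0, 1, Polynomial.X] rfl 2 rfl one_pos
    (X_mem 0) (by simp) ?_
  have h : Away.isLocalizationElem (X_mem (k := k) 1) (X_mem 0) = coord 1 0 := by
    simp [Away.isLocalizationElem, mk_eq_dehomogenize, dehomogenize]
  rw [h]
  intro i
  fin_cases i
  · simp
  · simp [coord_self]
  · simp

lemma exists_immersion_cellU3 :
    ∃ f : Spec (.of (Polynomial k)) ⟶ ProjPlane k, IsImmersion f ∧ Set.range f = cellU3 k := by
  refine exists_immersion_of_parametrization k 2 ![Polynomial.X, Polynomial.X ^ 2, 1] rfl 0 rfl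
    two_pos (conic_mem k) (by simp) ?_
  have h : Away.isLocalizationElem (X_mem (k := k) 2) (conic_mem k) =
      coord 2 0 ^ 2 - coord 2 1 := by
    simp [Away.isLocalizationElem, mk_eq_dehomogenize, dehomogenize, coord_self]
  rw [h]
  intro i
  fin_cases i
  · simp
  · simp
  · simp [coord_self]

end Cells

section Dimension

variable (k : Type) [Field k]

lemma isPrime_span_X_image {σ : Type} (s : Set σ) :
    (Ideal.span (X '' s) : Ideal (MvPolynomial σ k)).IsPrime := by
  classical
  let r : MvPolynomial σ k →ₐ[k] MvPolynomial σ k := aeval fun i ↦ if i ∈ s then 0 else X i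
  have hr : Ideal.span (X '' s) = RingHom.ker r := by
    apply le_antisymm
    · rw [Ideal.span_le]
      rintro _ ⟨i, hi, rfl⟩
      simp [r, hi]
    · intro p hp
      have hX {i : σ} (hi : i ∈ s) : (X i : MvPolynomial σ k) ∈ Ideal.span (X '' s) :=
        Ideal.subset_span (Set.mem_image_of_mem _ hi)
      have h : (Ideal.Quotient.mkₐ k (Ideal.span (X '' s : Set (MvPolynomial σ k)))).comp r =
          Ideal.Quotient.mkₐ k _ := by
        apply MvPolynomial.algHom_ext
        intro i
        by_cases hi : i ∈ s
        · simpa [r, hi] using (Ideal.Quotient.eq_zero_iff_mem.mpr (hX hi)).symm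
        · simp [r, hi]
      rw [← Ideal.Quotient.eq_zero_iff_mem]
      have h' := DFunLike.congr_fun h p
      rw [AlgHom.comp_apply, (RingHom.mem_ker).mp hp, map_zero] at h'
      exact h'.symm
  rw [hr]
  exact RingHom.ker_isPrime _

lemma X_mem_span_X_image_iff {σ : Type} {s : Set σ} {i : σ} :
    (X i : MvPolynomial σ k) ∈ Ideal.span (X '' s) ↔ i ∈ s := by
  classical
  rw [mem_ideal_span_X_image]
  simp [support_X, Finsupp.single_apply, eq_comm]

/-- The point of the projective plane whose homogeneous ideal is generated by a set of coordinates
omitting `x`. -/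
noncomputable def coordPoint (s : Set (Fin 3)) (hs : 0 ∉ s) : ProjPlane k :=
  show ProjectiveSpectrum (homogeneousSubmodule (Fin 3) k) from
  { asHomogeneousIdeal := ⟨Ideal.span (X '' s), Ideal.homogeneous_span _ _ (by
      rintro _ ⟨i, -, rfl⟩
      exact ⟨1, X_mem i⟩)⟩
    isPrime := isPrime_span_X_image k s
    not_irrelevant_le := fun h ↦ hs ((X_mem_span_X_image_iff k).mp
      (h (HomogeneousIdeal.mem_irrelevant_of_mem _ one_pos (X_mem (k := k) 0)))) }

lemma coordPoint_mem_cellU1 (s : Set (Fin 3)) (hs : 0 ∉ s) : coordPoint k s hs ∈ cellU1 k := by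
  have hx : (X 0 : MvPolynomial (Fin 3) k) ∉ Ideal.span (X '' s) :=
    fun h ↦ hs ((X_mem_span_X_image_iff k).mp h)
  refine ⟨trivial, ?_⟩
  rintro (h | h)
  · exact hx (Set.singleton_subset_iff.mp h)
  · replace h : conic k ∈ Ideal.span (X '' s) := Set.singleton_subset_iff.mp h
    have h' : (Ideal.span (X '' s) : Ideal (MvPolynomial (Fin 3) k)) ≤
        RingHom.ker (aeval (R := k) ![(1 : k), 0, 0]) := by
      rw [Ideal.span_le]
      rintro _ ⟨i, hi, rfl⟩
      fin_cases i
      · exact (hs hi).elim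
      · simp
      · simp
    simpa using (RingHom.mem_ker).mp (h' h)

lemma coordPoint_specializes_iff {s t : Set (Fin 3)} (hs : 0 ∉ s) (ht : 0 ∉ t) :
    coordPoint k s hs ⤳ coordPoint k t ht ↔ s ⊆ t := by
  rw [specializes_iff_mem_closure]
  refine (ProjectiveSpectrum.le_iff_mem_closure _ _ _).symm.trans ?_
  change Ideal.span (X '' s) ≤ (Ideal.span (X '' t) : Ideal (MvPolynomial (Fin 3) k)) ↔ _
  rw [Ideal.span_le, Set.image_subset_iff]
  exact forall₂_congr fun i _ ↦ X_mem_span_X_image_iff k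

lemma two_le_topologicalKrullDim_cellU1 : 2 ≤ topologicalKrullDim (cellU1 k) := by
  let c (s : Set (Fin 3)) (hs : 0 ∉ s) : TopologicalSpace.IrreducibleCloseds (cellU1 k) :=
    ⟨closure {⟨_, coordPoint_mem_cellU1 k s hs⟩}, isIrreducible_singleton.closure, isClosed_closure⟩
  have hc {s t : Set (Fin 3)} (hs : 0 ∉ s) (ht : 0 ∉ t) : c s hs ≤ c t ht ↔ t ⊆ s := by
    rw [← coordPoint_specializes_iff k ht hs]
    refine specializes_iff_closure_subset.symm.trans ?_
    exact Topology.IsInducing.subtypeVal.specializes_iff.symm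
  have hlt {s t : Set (Fin 3)} (hs : 0 ∉ s) (ht : 0 ∉ t) (h : t ⊂ s) : c s hs < c t ht :=
    lt_of_le_not_ge ((hc hs ht).mpr h.1) fun h' ↦ h.2 ((hc ht hs).mp h')
  let p : LTSeries (TopologicalSpace.IrreducibleCloseds (cellU1 k)) :=
    { length := 2
      toFun := ![c {1, 2} (by simp), c {1} (by simp), c ∅ (by simp)]
      step := fun i ↦ by
        fin_cases i
        · exact hlt _ _ (by simp [Set.ssubset_iff_of_subset])
        · exact hlt _ _ (by simp) }
  exact Order.LTSeries.length_le_krullDim p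

end Dimension

section Decomposition

open HomogeneousLocalization

variable (k : Type) [Field k]

lemma isDomain_away_X_mul_conic :
    IsDomain (Away (homogeneousSubmodule (Fin 3) k) (X 0 * conic k)) := by
  have h0 : X 0 * conic k ≠ 0 := fun h ↦ by
    simpa using congr_arg (aeval (R := k) ![(1 : k), 0, 0]) h
  have := IsLocalization.isDomain_localization (powers_le_nonZeroDivisors_of_noZeroDivisors h0)
  exact (val_injective _).isDomain (algebraMap _ (Localization.Away (X 0 * conic k)))

variable {k}

lemma mem_zeroLocus_singleton {p : ProjectiveSpectrum (homogeneousSubmodule (Fin 3) k)}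
    {f : MvPolynomial (Fin 3) k} :
    p ∈ ProjectiveSpectrum.zeroLocus (homogeneousSubmodule (Fin 3) k) {f} ↔
      f ∈ p.asHomogeneousIdeal.toIdeal :=
  Set.singleton_subset_iff

variable (k)

lemma disjoint_cellU2_cellU3 : Disjoint (cellU2 k) (cellU3 k) := by
  refine Set.disjoint_left.mpr fun (p : ProjectiveSpectrum _) hp hq ↦ ?_
  obtain ⟨hx, hy⟩ := hp
  obtain ⟨hc, hz⟩ := hq
  have hyz := Ideal.sub_mem _
    (Ideal.pow_mem_of_mem _ (mem_zeroLocus_singleton.mp hx) 2 two_pos)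
    (mem_zeroLocus_singleton.mp hc)
  rw [sub_sub_cancel] at hyz
  exact (p.isPrime.mem_or_mem hyz).elim (fun h ↦ hy (mem_zeroLocus_singleton.mpr h))
    fun h ↦ hz (mem_zeroLocus_singleton.mpr h)

lemma exists_X_notMem (p : ProjectiveSpectrum (homogeneousSubmodule (Fin 3) k)) :
    ∃ i, X i ∉ p.asHomogeneousIdeal.toIdeal := by
  by_contra! h
  refine p.not_irrelevant_le ((HomogeneousIdeal.irrelevant_le _).mpr fun d hd f hf ↦ ?_)
  have hf' : f ∈ Ideal.span (X '' (Set.univ : Set (Fin 3))) := by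
    rw [mem_ideal_span_X_image]
    intro m hm
    by_contra! hm'
    have hm0 : m = 0 := Finsupp.ext fun i ↦ hm' i trivial
    have hd' := hf (mem_support_iff.mp hm)
    rw [hm0, map_zero] at hd'
    exact hd.ne hd'
  refine (Ideal.span_le.mpr ?_ : _ ≤ p.asHomogeneousIdeal.toIdeal) hf'
  rintro _ ⟨i, -, rfl⟩
  exact h i

lemma union_cells : cellU1 k ∪ cellU2 k ∪ cellU3 k = Set.univ := by
  refine Set.eq_univ_of_forall fun (p : ProjectiveSpectrum _) ↦ ?_
  have h1 : p ∈ cellU1 k ↔ ¬(X 0 ∈ p.asHomogeneousIdeal.toIdeal ∨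
      conic k ∈ p.asHomogeneousIdeal.toIdeal) :=
    (iff_of_eq (true_and _)).trans
      (not_congr (or_congr mem_zeroLocus_singleton mem_zeroLocus_singleton))
  have h2 : p ∈ cellU2 k ↔ X 0 ∈ p.asHomogeneousIdeal.toIdeal ∧
      X 1 ∉ p.asHomogeneousIdeal.toIdeal :=
    and_congr mem_zeroLocus_singleton (not_congr mem_zeroLocus_singleton)
  have h3 : p ∈ cellU3 k ↔ conic k ∈ p.asHomogeneousIdeal.toIdeal ∧
      X 2 ∉ p.asHomogeneousIdeal.toIdeal :=
    and_congr mem_zeroLocus_singleton (not_congr mem_zeroLocus_singleton)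
  have hyz : X 0 ∈ p.asHomogeneousIdeal.toIdeal → X 1 ∈ p.asHomogeneousIdeal.toIdeal →
      conic k ∈ p.asHomogeneousIdeal.toIdeal := fun hx hy ↦
    Ideal.sub_mem _ (Ideal.pow_mem_of_mem _ hx 2 two_pos) (Ideal.mul_mem_right _ _ hy)
  have hx : conic k ∈ p.asHomogeneousIdeal.toIdeal → X 2 ∈ p.asHomogeneousIdeal.toIdeal →
      X 0 ∈ p.asHomogeneousIdeal.toIdeal := fun hc hz ↦
    p.isPrime.mem_of_pow_mem 2 (by
      simpa using Ideal.add_mem _ hc (Ideal.mul_mem_left _ (X 1) hz))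
  have hp := exists_X_notMem k p
  rw [Fin.exists_fin_succ, Fin.exists_fin_two] at hp
  change X 0 ∉ _ ∨ X 1 ∉ _ ∨ X 2 ∉ _ at hp
  change (p ∈ cellU1 k ∨ p ∈ cellU2 k) ∨ p ∈ cellU3 k
  tauto

end Decomposition

/-- **Example (counterexample to Białynicki-Birula's Proposition 4.7).**
Over an algebraically closed field `k`, the subsets `U₁ = ℙ² ∖ (Y ∪ Z)`, `U₂ = Y ∖ V(y)`
and `U₃ = Z ∖ V(z)` of `ℙ² = Proj k[x,y,z]`, where `Y = V(x)` and `Z = V(x² − yz)`, are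
pairwise disjoint locally closed subsets covering `ℙ²`; each is irreducible and an affine
cell, and their Krull dimensions are `2`, `1`, `1` respectively.  In particular this is a
locally closed decomposition of the complete variety `ℙ²` into affine cells having no cell
of dimension `0`. -/
theorem bb_prop_4_7_counterexample (k : Type) [Field k] [IsAlgClosed k] :
    (Disjoint (cellU1 k) (cellU2 k) ∧ Disjoint (cellU1 k) (cellU3 k) ∧
      Disjoint (cellU2 k) (cellU3 k)) ∧
    cellU1 k ∪ cellU2 k ∪ cellU3 k = Set.univ ∧
    (IsLocallyClosed (cellU1 k) ∧ IsLocallyClosed (cellU2 k) ∧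
      IsLocallyClosed (cellU3 k)) ∧
    (IsIrreducible (cellU1 k) ∧ IsIrreducible (cellU2 k) ∧ IsIrreducible (cellU3 k)) ∧
    (IsAffineCell k (ProjPlane k) (cellU1 k) ∧ IsAffineCell k (ProjPlane k) (cellU2 k) ∧
      IsAffineCell k (ProjPlane k) (cellU3 k)) ∧
    (topologicalKrullDim (cellU1 k) = 2 ∧ topologicalKrullDim (cellU2 k) = 1 ∧
      topologicalKrullDim (cellU3 k) = 1) := by
  obtain ⟨g₁, _, h₁⟩ := exists_immersion_cellU1 k
  obtain ⟨g₂, _, h₂⟩ := exists_immersion_cellU2 k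
  obtain ⟨g₃, _, h₃⟩ := exists_immersion_cellU3 k
  have : IsDomain (HomogeneousLocalization.Away (homogeneousSubmodule (Fin 3) k)
      (X 0 * conic k)) := isDomain_away_X_mul_conic k
  have hd : ringKrullDim (Polynomial k) = 1 := by
    rw [Polynomial.ringKrullDim_of_isNoetherianRing, ringKrullDim_eq_zero_of_field, zero_add]
  have hC : (Polynomial.C : k →+* Polynomial k).FiniteType :=
    RingHom.finiteType_algebraMap.mpr inferInstance
  refine ⟨⟨?_, ?_, ?_⟩, ?_, ⟨?_, ?_, ?_⟩, ⟨?_, ?_, ?_⟩, ⟨?_, ?_, ?_⟩, ?_, ?_, ?_⟩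
  · exact Set.disjoint_left.mpr fun p hp hq ↦ hp.2 (Or.inl hq.1)
  · exact Set.disjoint_left.mpr fun p hp hq ↦ hp.2 (Or.inr hq.1)
  · exact disjoint_cellU2_cellU3 k
  · exact union_cells k
  · exact h₁ ▸ g₁.isLocallyClosed_range
  · exact h₂ ▸ g₂.isLocallyClosed_range
  · exact h₃ ▸ g₃.isLocallyClosed_range
  · exact h₁ ▸ isIrreducible_range_of_isDomain g₁
  · exact h₂ ▸ isIrreducible_range_of_isDomain g₂
  · exact h₃ ▸ isIrreducible_range_of_isDomain g₃
  · exact h₁ ▸ isAffineCell_range k g₁ _ (constHom_finiteType k (X_mul_conic_mem k))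
  · exact h₂ ▸ isAffineCell_range k g₂ _ hC
  · exact h₃ ▸ isAffineCell_range k g₃ _ hC
  · exact le_antisymm ((topologicalKrullDim_subspace_le _ _).trans
      (topologicalKrullDim_projPlane_le k)) (two_le_topologicalKrullDim_cellU1 k)
  · rw [← h₂, topologicalKrullDim_range, hd]
  · rw [← h₃, topologicalKrullDim_range, hd]
end
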